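/- arXiv:1306.4504 — 5 statements merged into one kernel-verified Lean document; each statement's English description precedes it below -/
import Mathlib

section
/- For an n-dimensional integral polytope Q in ℝ^n, the number of lattice points in Q is at most (n+1)! times the Euclidean volume of Q. -/
open MeasureTheory

/-- The order simplex. -/
def LPC.ordS (n : ℕ) : Set (Fin n → ℝ) := {x | Monotone x ∧ ∀ i, 0 ≤ x i ∧ x i ≤ 1}

theorem LPC.one_le_ordS (n : ℕ) : 1 ≤ (n.factorial : ENNReal) * volume (LPC.ordS n) := by
  have hsub : Set.Icc (0 : Fin n → ℝ) 1 ⊆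
      ⋃ σ : Equiv.Perm (Fin n), (fun x : Fin n → ℝ => x ∘ σ) ⁻¹' (LPC.ordS n) := by
    intro x hx
    refine Set.mem_iUnion.2 ⟨Tuple.sort x, Tuple.monotone_sort x, fun i => ?_⟩
    exact ⟨hx.1 _, hx.2 _⟩
  have hone : volume (Set.Icc (0 : Fin n → ℝ) 1) = 1 := by
    rw [Real.volume_Icc_pi]; simp
  have hm : ∀ σ : Equiv.Perm (Fin n),
      volume ((fun x : Fin n → ℝ => x ∘ σ) ⁻¹' (LPC.ordS n)) = volume (LPC.ordS n) := by
    intro σ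
    have h := volume_measurePreserving_piCongrLeft (fun _ : Fin n => ℝ) σ.symm
    have h2 := h.measure_preimage_equiv (LPC.ordS n)
    rw [← h2]
    have he : (fun x : Fin n → ℝ => x ∘ σ) =
        MeasurableEquiv.piCongrLeft (fun _ : Fin n => ℝ) σ.symm := by
      ext x i
      obtain ⟨j, rfl⟩ := σ.symm.surjective i
      rw [MeasurableEquiv.coe_piCongrLeft, Equiv.piCongrLeft_apply_apply]
      simp
    rw [he]
  calc (1 : ENNReal) = volume (Set.Icc (0 : Fin n → ℝ) 1) := hone.symm
    _ ≤ _ := measure_mono hsub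
    _ ≤ ∑ σ : Equiv.Perm (Fin n), volume ((fun x : Fin n → ℝ => x ∘ σ) ⁻¹' (LPC.ordS n)) :=
      measure_iUnion_fintype_le _ _
    _ = _ := by
      simp [hm, Fintype.card_perm]

/-- Homogenization. -/
def LPC.hom {n : ℕ} (x : Fin n → ℝ) : ℝ × (Fin n → ℝ) := (1, x)

theorem LPC.simplex_vol {n : ℕ} (t : Fin (n+1) → (Fin n → ℤ))
    (ht : LinearIndependent ℝ (fun k => LPC.hom (fun i => (t k i : ℝ)))) :
    1 ≤ (n.factorial : ENNReal) *
      volume (convexHull ℝ (Set.range (fun k => (fun i => (t k i : ℝ))))) := by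
  set T : Fin (n+1) → (Fin n → ℝ) := fun k i => (t k i : ℝ) with hT
  let N : Matrix (Fin n) (Fin n) ℤ := Matrix.of fun j i => t i.castSucc j - t i.succ j
  let M : Matrix (Fin n) (Fin n) ℝ := N.map (Int.castRingHom ℝ)
  have hM : ∀ x : Fin n → ℝ, M.mulVec x = ∑ i, x i • (T i.castSucc - T i.succ) := by
    intro x
    ext j
    simp [M, N, Matrix.mulVec, dotProduct, hT, mul_comm]
  have hcomb : ∀ (x : Fin n → ℝ) (c : ℝ),
      ∑ k : Fin (n+1), ((Fin.snoc x c : Fin (n+1) → ℝ) k - (Fin.cons 0 x : Fin (n+1) → ℝ) k) • T k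
        = c • T (Fin.last n) + M.mulVec x := by
    intro x c
    simp only [sub_smul, Finset.sum_sub_distrib, hM, smul_sub]
    rw [Fin.sum_univ_castSucc, Fin.sum_univ_succ (n := n)]
    simp
    abel
  have hsum : ∀ (x : Fin n → ℝ) (c : ℝ),
      ∑ k : Fin (n+1), ((Fin.snoc x c : Fin (n+1) → ℝ) k - (Fin.cons 0 x : Fin (n+1) → ℝ) k)
        = c := by
    intro x c
    rw [Finset.sum_sub_distrib, Fin.sum_univ_castSucc, Fin.sum_univ_succ (n := n)]
    simp
  have hdet : M.det ≠ 0 := by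
    intro h0
    obtain ⟨x, hx0, hx⟩ := Matrix.exists_mulVec_eq_zero_iff.2 h0
    apply hx0
    have hl := Fintype.linearIndependent_iff.1 ht
      (fun k => (Fin.snoc x 0 : Fin (n+1) → ℝ) k - (Fin.cons 0 x : Fin (n+1) → ℝ) k) (by
        have h2 := hcomb x 0
        rw [hx, zero_smul, zero_add] at h2
        refine Prod.ext ?_ ?_
        · rw [Prod.fst_sum]; simp [LPC.hom]
        · rw [Prod.snd_sum]; exact h2)
    have key : ∀ k : Fin (n+1), (Fin.cons 0 x : Fin (n+1) → ℝ) k = 0 := by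
      intro k
      induction k using Fin.induction with
      | zero => simp
      | succ i ih =>
        have := hl i.castSucc
        rw [ih] at this
        simpa using this
    ext i
    simpa using key i.succ
  have hdet1 : 1 ≤ |M.det| := by
    have h : M.det = (N.det : ℝ) := by
      simp only [M]
      exact (RingHom.map_det (Int.castRingHom ℝ) N).symm
    rw [h] at hdet ⊢
    have : N.det ≠ 0 := by exact_mod_cast hdet
    exact_mod_cast Int.one_le_abs this
  have hsub : (fun y => T (Fin.last n) + y) '' ((Matrix.toLin' M) '' (LPC.ordS n)) ⊆
      convexHull ℝ (Set.range T) := by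
    rintro _ ⟨_, ⟨x, ⟨hx, hx1⟩, rfl⟩, rfl⟩
    have h := hcomb x 1
    rw [one_smul] at h
    simp only [Matrix.toLin'_apply]
    rw [← h]
    refine (convex_convexHull ℝ _).sum_mem ?_ (hsum x 1)
      (fun k _ => subset_convexHull ℝ _ (Set.mem_range_self k))
    intro k _
    rw [sub_nonneg]
    induction k using Fin.lastCases with
    | last =>
      rw [Fin.snoc_last]
      cases n with
      | zero => simp
      | succ m => rw [← Fin.succ_last, Fin.cons_succ]; exact (hx1 _).2
    | cast i =>
      rw [Fin.snoc_castSucc]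
      cases n with
      | zero => exact i.elim0
      | succ m =>
        induction i using Fin.cases with
        | zero => simpa using (hx1 0).1
        | succ j =>
          rw [← Fin.succ_castSucc, Fin.cons_succ]
          exact hx (Fin.castSucc_le_succ j)
  calc (1 : ENNReal) ≤ (n.factorial : ENNReal) * volume (LPC.ordS n) := LPC.one_le_ordS n
    _ ≤ (n.factorial : ENNReal) * volume ((fun y => T (Fin.last n) + y) '' ((Matrix.toLin' M) '' (LPC.ordS n))) := by
      refine mul_le_mul' le_rfl ?_
      rw [Set.image_add_left, measure_preimage_add, Measure.addHaar_image_linearMap,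
        LinearMap.det_toLin']
      have : (1 : ENNReal) ≤ ENNReal.ofReal |M.det| := by simpa using hdet1
      exact le_mul_of_one_le_left (zero_le) this
    _ ≤ _ := by gcongr

theorem LPC.null {n : ℕ} (g : Module.Dual ℝ (ℝ × (Fin n → ℝ))) (hg : g ≠ 0) :
    volume {x : Fin n → ℝ | g (LPC.hom x) = 0} = 0 := by
  let A : AffineSubspace ℝ (Fin n → ℝ) :=
    { carrier := {x | g (LPC.hom x) = 0}
      smul_vsub_vadd_mem' := by
        intro c p q r hp hq hr
        simp only [Set.mem_ofPred_eq] at *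
        have : LPC.hom (c • (p -ᵥ q) +ᵥ r) = c • (LPC.hom p - LPC.hom q) + LPC.hom r := by
          simp [LPC.hom]
        rw [this, map_add, map_smul, map_sub, hp, hq, hr]; simp }
  have hA : A ≠ ⊤ := by
    intro h
    have h1 : ∀ x, g (LPC.hom x) = 0 := by
      intro x
      have : x ∈ A := by rw [h]; trivial
      exact this
    apply hg
    apply LinearMap.ext
    rintro ⟨a, x⟩
    have : ((a, x) : ℝ × (Fin n → ℝ)) = LPC.hom x + (a - 1) • LPC.hom 0 := by
      simp [LPC.hom]
    rw [this, map_add, map_smul, h1, h1]; simp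
  exact Measure.addHaar_affineSubspace volume A hA

theorem LPC.exists_full {F ι : Type*} [AddCommGroup F] [Module ℝ F] [FiniteDimensional ℝ F]
    [Fintype ι] (v : ι → F) (hv : Submodule.span ℝ (Set.range v) = ⊤) (ω : ι → ℝ)
    (f0 : Module.Dual ℝ F) (h0 : ∀ i, f0 (v i) ≤ ω i) (p : ι) (hp : f0 (v p) = ω p) :
    ∃ f : Module.Dual ℝ F, (∀ i, f (v i) ≤ ω i) ∧ f (v p) = ω p ∧
      Submodule.span ℝ (v '' {i | f (v i) = ω i}) = ⊤ := by
  classical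
  by_contra! hcon
  have step : ∀ m : ℕ, ∃ f : Module.Dual ℝ F, (∀ i, f (v i) ≤ ω i) ∧ f (v p) = ω p ∧
      m ≤ (Finset.univ.filter fun i => f (v i) = ω i).card := by
    intro m
    induction m with
    | zero => exact ⟨f0, h0, hp, Nat.zero_le _⟩
    | succ m ih =>
      obtain ⟨f, hf, hfp, hm⟩ := ih
      have hne := hcon f hf hfp
      obtain ⟨g, hg0, hg⟩ := Submodule.exists_le_ker_of_lt_top _ (lt_top_iff_ne_top.2 hne)
      have hgt : ∀ i, f (v i) = ω i → g (v i) = 0 := fun i hi =>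
        hg (Submodule.subset_span ⟨i, hi, rfl⟩)
      obtain ⟨g, hgt, j0, hj0⟩ : ∃ g : Module.Dual ℝ F, (∀ i, f (v i) = ω i → g (v i) = 0) ∧
          ∃ j, 0 < g (v j) := by
        have : ∃ j, g (v j) ≠ 0 := by
          by_contra! h
          apply hg0
          exact LinearMap.ext_on_range hv (by simpa using h)
        obtain ⟨j, hj⟩ := this
        rcases lt_or_gt_of_ne hj with h | h
        · exact ⟨-g, fun i hi => by simp [hgt i hi], j, by simpa using h⟩
        · exact ⟨g, hgt, j, h⟩
      obtain ⟨k, hk, hmin⟩ := (Finset.univ.filter fun j => 0 < g (v j)).exists_min_image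
        (fun j => (ω j - f (v j)) / g (v j)) ⟨j0, by simpa using hj0⟩
      have hk' : 0 < g (v k) := by simpa using hk
      set s := (ω k - f (v k)) / g (v k) with hs
      have hs0 : 0 ≤ s := div_nonneg (sub_nonneg.2 (hf k)) hk'.le
      refine ⟨f + s • g, ?_, ?_, ?_⟩
      · intro i
        simp only [LinearMap.add_apply, LinearMap.smul_apply, smul_eq_mul]
        rcases lt_or_ge 0 (g (v i)) with h | h
        · have := hmin i (by simpa using h)
          rw [le_div_iff₀ h] at this
          linarith
        · have := hf i
          nlinarith
      · simp [hgt p hfp, hfp]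
      · refine le_trans (Nat.succ_le_succ hm) (Nat.succ_le_of_lt (Finset.card_lt_card ?_))
        rw [Finset.ssubset_iff_of_subset]
        · refine ⟨k, ?_, ?_⟩
          · simp [hs]; field_simp; ring
          · simp only [Finset.mem_filter, Finset.mem_univ, true_and]
            intro h
            exact hk'.ne' (hgt k h)
        · intro i hi
          have hi' : f (v i) = ω i := by simpa using hi
          simp [hi', hgt i hi']
  obtain ⟨f, -, -, h⟩ := step (Fintype.card ι + 1)
  have := Finset.card_le_univ (Finset.univ.filter fun i => f (v i) = ω i)
  omega

theorem LPC.generic {F ι : Type*} [AddCommGroup F] [Module ℝ F] [FiniteDimensional ℝ F]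
    [Fintype ι] (v : ι → F) (ω₀ : ι → ℝ) :
    ∃ ω : ι → ℝ, (∀ i, |ω i - ω₀ i| < 1/2) ∧
      ∀ (f : Module.Dual ℝ F) (U : Finset ι), (∀ i ∈ U, f (v i) = ω i) →
        U.card ≤ Module.finrank ℝ F := by
  classical
  let W : Finset ι → Submodule ℝ (ι → ℝ) := fun U =>
    { carrier := {ω | ∃ f : Module.Dual ℝ F, ∀ i ∈ U, f (v i) = ω i}
      zero_mem' := ⟨0, by simp⟩
      add_mem' := by
        rintro a b ⟨f, hf⟩ ⟨g, hg⟩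
        exact ⟨f + g, fun i hi => by simp [hf i hi, hg i hi]⟩
      smul_mem' := by
        rintro c a ⟨f, hf⟩
        exact ⟨c • f, fun i hi => by simp [hf i hi]⟩ }
  have hW : ∀ U : Finset ι, Module.finrank ℝ F < U.card → W U ≠ ⊤ := by
    intro U hU htop
    let L : Module.Dual ℝ F →ₗ[ℝ] (U → ℝ) := LinearMap.pi fun i => Module.Dual.eval ℝ F (v i)
    have hsurj : Function.Surjective L := by
      intro y
      have hmem : (fun i => if h : i ∈ U then y ⟨i, h⟩ else 0) ∈ W U := by rw [htop]; trivial
      obtain ⟨f, hf⟩ := hmem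
      refine ⟨f, ?_⟩
      ext ⟨i, hi⟩
      have := hf i hi
      simpa [L, hi] using this
    have := LinearMap.finrank_le_finrank_of_surjective hsurj
    rw [Subspace.dual_finrank_eq] at this
    simp at this
    omega
  let B : Set (ι → ℝ) := ⋃ U ∈ {U : Finset ι | Module.finrank ℝ F < U.card}, (W U : Set (ι → ℝ))
  have hB : volume B = 0 := by
    refine (measure_biUnion_null_iff (Set.to_countable _)).2 ?_
    intro U hU
    exact Measure.addHaar_submodule _ _ (hW U hU)
  have hpos : 0 < volume (Metric.ball ω₀ (1/2)) := Metric.measure_ball_pos _ _ (by norm_num)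
  obtain ⟨ω, hω, hωB⟩ : ∃ ω ∈ Metric.ball ω₀ (1/2), ω ∉ B := by
    by_contra! h
    exact hpos.ne' (measure_mono_null h hB)
  refine ⟨ω, fun i => ?_, fun f U hU => ?_⟩
  · rw [Metric.mem_ball, dist_pi_lt_iff (by norm_num)] at hω
    exact hω i
  · by_contra! hc
    exact hωB (Set.mem_biUnion (x := U) hc ⟨f, hU⟩)

theorem lattice_point_count_le (n : ℕ) (V : Finset (Fin n → ℤ)) (Q : Set (Fin n → ℝ))
    (hQ : Q = convexHull ℝ ((fun v : Fin n → ℤ => fun i => (v i : ℝ)) '' V))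
    (hfull : (interior Q).Nonempty) :
    (Nat.card {x : Fin n → ℤ // (fun i => (x i : ℝ)) ∈ Q} : ℝ) ≤
      (Nat.factorial (n + 1) : ℝ) * (volume Q).toReal := by
  classical
  set ι := {x : Fin n → ℤ // (fun i => (x i : ℝ)) ∈ Q} with hι
  rcases finite_or_infinite ι with hfin | hinf
  swap
  · rw [Nat.card_eq_zero_of_infinite]
    simp only [Nat.cast_zero]
    positivity
  have := Fintype.ofFinite ι
  have hQc : IsCompact Q := by
    rw [hQ]
    exact (V.finite_toSet.image _).isCompact_convexHull ℝ
  have hQconv : Convex ℝ Q := by rw [hQ]; exact convex_convexHull ℝ _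
  let P : ι → (Fin n → ℝ) := fun x i => (x.1 i : ℝ)
  let v : ι → ℝ × (Fin n → ℝ) := fun x => LPC.hom (P x)
  have hrank : Module.finrank ℝ (ℝ × (Fin n → ℝ)) = n + 1 := by simp [add_comm]
  -- affine evaluation on convex hulls
  have hconv : ∀ (f : Module.Dual ℝ (ℝ × (Fin n → ℝ))), Convex ℝ {x | f (LPC.hom x) ≤ 0} := by
    intro f x hx y hy a b ha hb hab
    have : LPC.hom (a • x + b • y) = a • LPC.hom x + b • LPC.hom y := by
      simp [LPC.hom, hab]
    simp only [Set.mem_ofPred_eq] at *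
    rw [this, map_add, map_smul, map_smul, smul_eq_mul, smul_eq_mul]
    nlinarith
  have hspan : Submodule.span ℝ (Set.range v) = ⊤ := by
    by_contra hne
    obtain ⟨g, hg0, hg⟩ := Submodule.exists_le_ker_of_lt_top _ (lt_top_iff_ne_top.2 hne)
    have hgv : ∀ i, g (v i) = 0 := fun i => hg (Submodule.subset_span ⟨i, rfl⟩)
    have hVQ : ∀ f : Module.Dual ℝ (ℝ × (Fin n → ℝ)), (∀ i, f (v i) = 0) →
        Q ⊆ {x | f (LPC.hom x) ≤ 0} := by
      intro f hf
      conv_lhs => rw [hQ]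
      refine convexHull_min ?_ (hconv f)
      rintro _ ⟨w, hw, rfl⟩
      have hwQ : (fun i => (w i : ℝ)) ∈ Q := by
        rw [hQ]; exact subset_convexHull ℝ _ ⟨w, hw, rfl⟩
      exact (hf ⟨w, hwQ⟩).le
    have hsub : interior Q ⊆ {x | g (LPC.hom x) = 0} := by
      intro x hx
      have h1 := hVQ g hgv (interior_subset hx)
      have h2 := hVQ (-g) (by simpa using hgv) (interior_subset hx)
      simp only [Set.mem_ofPred_eq, LinearMap.neg_apply] at *
      linarith
    exact (isOpen_interior.measure_pos volume hfull).ne' (measure_mono_null hsub (LPC.null g hg0))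
  obtain ⟨ω, hω, hgen⟩ := LPC.generic v (fun i => ∑ j, (P i j)^2)
  let good : Finset ι → Prop := fun T => ∃ f : Module.Dual ℝ (ℝ × (Fin n → ℝ)),
    (∀ i, f (v i) ≤ ω i) ∧ (∀ i, i ∈ T ↔ f (v i) = ω i) ∧
      Submodule.span ℝ (v '' {i | f (v i) = ω i}) = ⊤
  let 𝒯 : Finset (Finset ι) := Finset.univ.filter good
  have hcover : ∀ p : ι, ∃ T ∈ 𝒯, p ∈ T := by
    intro p
    let f0 : Module.Dual ℝ (ℝ × (Fin n → ℝ)) :=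
      (ω p - 2 * ∑ j, (P p j)^2) • LinearMap.fst ℝ ℝ (Fin n → ℝ) +
        ∑ j, (2 * P p j) • ((LinearMap.proj j : (Fin n → ℝ) →ₗ[ℝ] ℝ) ∘ₗ
          LinearMap.snd ℝ ℝ (Fin n → ℝ))
    have hf0 : ∀ i, f0 (v i) = ∑ j, (P i j)^2 - ∑ j, (P i j - P p j)^2
        + (ω p - ∑ j, (P p j)^2) := by
      intro i
      have : ∑ j, (P i j - P p j)^2 =
          ∑ j, (P i j)^2 - ∑ j, (2 * P p j) * P i j + ∑ j, (P p j)^2 := by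
        rw [← Finset.sum_sub_distrib, ← Finset.sum_add_distrib]
        exact Finset.sum_congr rfl fun j _ => by ring
      rw [this]
      simp [f0, v, LPC.hom, LinearMap.sum_apply]
      ring
    have hp : f0 (v p) = ω p := by rw [hf0]; simp
    have hle : ∀ i, f0 (v i) ≤ ω i := by
      intro i
      by_cases hip : i = p
      · rw [hip, hp]
      · have hne : ∃ j, i.1 j ≠ p.1 j := by
          by_contra! h
          exact hip (Subtype.ext (funext h))
        obtain ⟨j, hj⟩ := hne
        have h1 : 1 ≤ (P i j - P p j)^2 := by
          have : 1 ≤ (i.1 j - p.1 j)^2 := by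
            have : 0 < (i.1 j - p.1 j)^2 := by
              have := sub_ne_zero.2 hj
              positivity
            omega
          simp only [P]
          exact_mod_cast this
        have h2 : (P i j - P p j)^2 ≤ ∑ j, (P i j - P p j)^2 :=
          Finset.single_le_sum (f := fun j => (P i j - P p j)^2)
            (fun _ _ => sq_nonneg _) (Finset.mem_univ j)
        have h3 := abs_lt.1 (hω i)
        have h4 := abs_lt.1 (hω p)
        rw [hf0]
        linarith [h3.1, h4.2]
    obtain ⟨f, hf1, hf2, hf3⟩ := LPC.exists_full v hspan ω f0 hle p hp
    refine ⟨Finset.univ.filter fun i => f (v i) = ω i, ?_, by simpa using hf2⟩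
    simp only [𝒯, Finset.mem_filter, Finset.mem_univ, true_and]
    exact ⟨f, hf1, by simp, hf3⟩
  have hcardT : ∀ T ∈ 𝒯, T.card = n + 1 ∧ LinearIndependent ℝ (fun i : T => v i) := by
    intro T hT
    obtain ⟨f, hf1, hf2, hf3⟩ := (Finset.mem_filter.1 hT).2
    have hle := hgen f T (fun i hi => (hf2 i).1 hi)
    have hTs : {i | f (v i) = ω i} = (T : Set ι) := by ext i; simp [hf2 i]
    rw [hTs] at hf3
    have hrg : Set.range (fun i : T => v i) = v '' (T : Set ι) := by
      ext; simp
    have hge : ⊤ ≤ Submodule.span ℝ (Set.range (fun i : T => v i)) := by rw [hrg, hf3]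
    have hge2 : Module.finrank ℝ (ℝ × (Fin n → ℝ)) ≤ T.card := by
      have := finrank_range_le_card (R := ℝ) (fun i : T => v i)
      rw [Set.finrank, top_le_iff.1 hge, finrank_top] at this
      simpa using this
    have hc : T.card = Module.finrank ℝ (ℝ × (Fin n → ℝ)) := le_antisymm hle hge2
    exact ⟨hc.trans hrank, linearIndependent_of_top_le_span_of_card_eq_finrank hge (by simpa using hc)⟩
  let C : Finset ι → Set (Fin n → ℝ) := fun T => convexHull ℝ (P '' (T : Set ι))
  have hvol : ∀ T ∈ 𝒯, 1 ≤ (n.factorial : ENNReal) * volume (C T) := by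
    intro T hT
    obtain ⟨hc, hli⟩ := hcardT T hT
    let e : Fin (n+1) ≃ T := (T.equivFinOfCardEq hc).symm
    have h := LPC.simplex_vol (fun k => (e k).1.1) (hli.comp e e.injective)
    have hr : Set.range (fun k => (fun i => (((e k).1.1 i : ℤ) : ℝ))) = P '' (T : Set ι) := by
      ext y
      constructor
      · rintro ⟨k, rfl⟩
        exact ⟨(e k).1, (e k).2, rfl⟩
      · rintro ⟨i, hi, rfl⟩
        exact ⟨e.symm ⟨i, hi⟩, by simp [P]⟩
    rw [hr] at h
    exact h
  have hdisj : (𝒯 : Set (Finset ι)).Pairwise (fun S T => AEDisjoint volume (C S) (C T)) := by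
    intro S hS T hT hST
    obtain ⟨f, hf1, hf2, -⟩ := (Finset.mem_filter.1 (Finset.mem_coe.1 hS)).2
    obtain ⟨g, hg1, hg2, -⟩ := (Finset.mem_filter.1 (Finset.mem_coe.1 hT)).2
    have hfg : f - g ≠ 0 := by
      intro h
      rw [sub_eq_zero] at h
      apply hST
      ext i
      rw [hf2, hg2, h]
    refine measure_mono_null ?_ (LPC.null (f - g) hfg)
    rintro x ⟨hxS, hxT⟩
    have h1 : C S ⊆ {x | (g - f) (LPC.hom x) ≤ 0} := by
      refine convexHull_min ?_ (hconv _)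
      rintro _ ⟨i, hi, rfl⟩
      have h1 := (hf2 i).1 hi
      have h2 := hg1 i
      simp only [Set.mem_ofPred_eq, LinearMap.sub_apply]
      simp only [v] at h1 h2
      linarith
    have h2 : C T ⊆ {x | (f - g) (LPC.hom x) ≤ 0} := by
      refine convexHull_min ?_ (hconv _)
      rintro _ ⟨i, hi, rfl⟩
      have h1 := (hg2 i).1 hi
      have h2 := hf1 i
      simp only [Set.mem_ofPred_eq, LinearMap.sub_apply]
      simp only [v] at h1 h2
      linarith
    have h1 := h1 hxS
    have h2 := h2 hxT
    simp only [Set.mem_ofPred_eq, LinearMap.sub_apply] at *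
    linarith
  have hmeas : ∀ T ∈ 𝒯, NullMeasurableSet (C T) volume := by
    intro T _
    exact ((T.finite_toSet.image P).isCompact_convexHull ℝ).isClosed.measurableSet.nullMeasurableSet
  have hsum : ∑ T ∈ 𝒯, volume (C T) ≤ volume Q := by
    rw [← measure_biUnion_finset₀ hdisj hmeas]
    refine measure_mono (Set.iUnion₂_subset fun T _ => convexHull_min ?_ hQconv)
    rintro _ ⟨i, _, rfl⟩
    exact i.2
  have hcount : (𝒯.card : ENNReal) ≤ (n.factorial : ENNReal) * volume Q := by
    calc (𝒯.card : ENNReal) = ∑ T ∈ 𝒯, 1 := by simp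
      _ ≤ ∑ T ∈ 𝒯, (n.factorial : ENNReal) * volume (C T) := Finset.sum_le_sum hvol
      _ = (n.factorial : ENNReal) * ∑ T ∈ 𝒯, volume (C T) := by rw [Finset.mul_sum]
      _ ≤ _ := by gcongr
  have hcountR : (𝒯.card : ℝ) ≤ (n.factorial : ℝ) * (volume Q).toReal := by
    have h := ENNReal.toReal_mono
      (ENNReal.mul_ne_top (ENNReal.natCast_ne_top _) hQc.measure_lt_top.ne) hcount
    simpa using h
  have hcard : Nat.card ι ≤ 𝒯.card * (n + 1) := by
    rw [Nat.card_eq_fintype_card, ← Finset.card_univ]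
    have : (Finset.univ : Finset ι) ⊆ 𝒯.biUnion id := by
      intro p _
      obtain ⟨T, hT, hp⟩ := hcover p
      exact Finset.mem_biUnion.2 ⟨T, hT, hp⟩
    exact (Finset.card_le_card this).trans
      (Finset.card_biUnion_le_card_mul _ _ _ fun T hT => (hcardT T hT).1.le)
  have hcard' : (Nat.card ι : ℝ) ≤ 𝒯.card * (n + 1) := by exact_mod_cast hcard
  rw [Nat.factorial_succ]
  push_cast
  nlinarith [(Nat.cast_nonneg n : (0 : ℝ) ≤ n)]
end

section
/- For an n-dimensional integral polytope Q in ℝ^n, equality Card(Q ∩ ℤ^n) = (n+1)!·Vol(Q) holds if and only if Q is unimodularly equivalent to the standard n-simplex Δ_n = Conv{0, e_1, …, e_n}. -/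
open MeasureTheory

/-- The standard n-simplex Δ_n = Conv{0, e_1, …, e_n} in ℝ^n. -/
def stdSimplexSet (n : ℕ) : Set (Fin n → ℝ) :=
  convexHull ℝ
    (insert (0 : Fin n → ℝ) (Set.range fun i : Fin n => fun j => if i = j then (1 : ℝ) else 0))

/-- Q is unimodularly equivalent to the standard n-simplex: Q is the image of Δ_n
under x ↦ Ax + b with A ∈ GL_n(ℤ) and b ∈ ℤ^n. -/
def UnimodEquivStdSimplex (n : ℕ) (Q : Set (Fin n → ℝ)) : Prop :=
  ∃ (A : Matrix (Fin n) (Fin n) ℤ) (b : Fin n → ℤ), IsUnit A.det ∧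
    Q = (fun x : Fin n → ℝ => fun i => (∑ j, (A i j : ℝ) * x j) + (b i : ℝ)) '' stdSimplexSet n

def cornerSet (n : ℕ) (r : ℝ) : Set (Fin n → ℝ) := {x | (∀ i, 0 ≤ x i) ∧ ∑ i, x i ≤ r}

lemma stdSimplexSet_eq (n : ℕ) : stdSimplexSet n = cornerSet n 1 := by
  apply Set.Subset.antisymm
  · refine convexHull_min ?_ ?_
    · intro x hx
      rcases hx with rfl | ⟨i, rfl⟩
      · simp [cornerSet]
      · refine ⟨fun j => ?_, ?_⟩
        · dsimp only; split_ifs <;> norm_num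
        · simp
    · rintro x ⟨hx, hx'⟩ y ⟨hy, hy'⟩ a b ha hb hab
      refine ⟨fun i => ?_, ?_⟩
      · have := mul_nonneg ha (hx i)
        have := mul_nonneg hb (hy i)
        simp; linarith
      · simp only [Pi.add_apply, Pi.smul_apply, smul_eq_mul, Finset.sum_add_distrib,
          ← Finset.mul_sum]
        nlinarith
  · rintro x ⟨hx, hx'⟩
    have hc : Convex ℝ (stdSimplexSet n) := convex_convexHull ℝ _
    let z : Option (Fin n) → (Fin n → ℝ) := fun o => o.elim 0 (fun i => fun j => if i = j then 1 else 0)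
    let w : Option (Fin n) → ℝ := fun o => o.elim (1 - ∑ i, x i) x
    have := hc.sum_mem (t := Finset.univ) (w := w) (z := z) ?_ ?_ ?_
    · convert this using 1
      rw [Fintype.sum_option]
      ext j
      simp [z, w, Finset.sum_apply]
    · rintro (_ | i) _
      · simp [w]; linarith
      · simpa [w] using hx i
    · rw [Fintype.sum_option]; simp [w]
    · rintro (_ | i) _
      · exact subset_convexHull ℝ _ (by simp [z])
      · exact subset_convexHull ℝ _ (by right; exact ⟨i, rfl⟩)

lemma measurableSet_cornerSet (n : ℕ) (r : ℝ) : MeasurableSet (cornerSet n r) := by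
  have : cornerSet n r = (⋂ i, {x : Fin n → ℝ | 0 ≤ x i}) ∩ {x | ∑ i, x i ≤ r} := by
    ext x; simp [cornerSet]
  rw [this]
  refine MeasurableSet.inter (MeasurableSet.iInter fun i => ?_) ?_
  · exact measurableSet_le measurable_const (measurable_pi_apply i)
  · exact measurableSet_le (by fun_prop) measurable_const

lemma volume_cornerSet (n : ℕ) : ∀ r : ℝ, 0 ≤ r →
    volume (cornerSet n r) = ENNReal.ofReal (r ^ n / (Nat.factorial n : ℝ)) := by
  induction n with
  | zero =>
    intro r hr
    have : cornerSet 0 r = Set.univ := by ext x; simp [cornerSet, hr]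
    rw [this, volume_pi, Measure.pi_of_empty]; simp
  | succ n ih =>
    intro r hr
    have mp := (MeasureTheory.volume_preserving_piFinSuccAbove (fun _ : Fin (n+1) => ℝ) 0).symm
    rw [← mp.measure_preimage (measurableSet_cornerSet _ _).nullMeasurableSet]
    rw [MeasureTheory.Measure.volume_eq_prod]
    rw [MeasureTheory.Measure.prod_apply (mp.measurable (measurableSet_cornerSet _ _))]
    have key : ∀ t : ℝ, volume (Prod.mk t ⁻¹' ((MeasurableEquiv.piFinSuccAbove (fun _ : Fin (n+1) => ℝ) 0).symm ⁻¹'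
        cornerSet (n+1) r)) = (Set.Icc 0 r).indicator
          (fun t => ENNReal.ofReal ((r - t) ^ n / (Nat.factorial n : ℝ))) t := by
      intro t
      have hmem : ∀ y : Fin n → ℝ, y ∈ (Prod.mk t ⁻¹' ((MeasurableEquiv.piFinSuccAbove (fun _ : Fin (n+1) => ℝ) 0).symm ⁻¹'
        cornerSet (n+1) r)) ↔ 0 ≤ t ∧ y ∈ cornerSet n (r - t) := by
        intro y
        simp only [Set.mem_preimage, cornerSet, Set.mem_ofPred_eq, MeasurableEquiv.piFinSuccAbove_symm_apply, Fin.forall_fin_succ, Fin.sum_univ_succ, Fin.insertNthEquiv]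
        simp
        rw [and_assoc, le_sub_iff_add_le']
      by_cases ht : t ∈ Set.Icc 0 r
      · rw [Set.indicator_of_mem ht, ← ih (r - t) (by linarith [ht.2])]
        congr 1
        ext y
        rw [hmem]; simp [ht.1]
      · rw [Set.indicator_of_notMem ht]
        convert measure_empty (μ := (volume : Measure (Fin n → ℝ))) using 2
        ext y
        rw [hmem]
        simp only [Set.mem_empty_iff_false, iff_false, not_and]
        intro h0 hy
        have := Finset.sum_nonneg (s := Finset.univ) fun i _ => hy.1 i
        exact ht ⟨h0, by linarith [hy.2]⟩
    simp_rw [key]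
    rw [lintegral_indicator measurableSet_Icc, ← ofReal_integral_eq_lintegral_ofReal]
    · congr 1
      rw [integral_Icc_eq_integral_Ioc, ← intervalIntegral.integral_of_le hr,
        intervalIntegral.integral_comp_sub_left (fun x => x ^ n / (Nat.factorial n : ℝ))]
      simp only [sub_self, sub_zero, intervalIntegral.integral_div, integral_pow]
      rw [Nat.factorial_succ]
      have : (Nat.factorial n : ℝ) ≠ 0 := by positivity
      push_cast
      field_simp
      simp
    · apply Continuous.integrableOn_Icc
      fun_prop
    · filter_upwards [ae_restrict_mem measurableSet_Icc] with t ht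
      have : 0 ≤ r - t := by linarith [ht.2]
      simp only [Pi.zero_apply]
      positivity

lemma volume_stdSimplexSet (n : ℕ) :
    volume (stdSimplexSet n) = ENNReal.ofReal (1 / (Nat.factorial n : ℝ)) := by
  rw [stdSimplexSet_eq, volume_cornerSet n 1 zero_le_one]; simp

/-- the affine map of the statement -/
def uMap {n : ℕ} (A : Matrix (Fin n) (Fin n) ℤ) (b : Fin n → ℤ) : (Fin n → ℝ) →ᵃ[ℝ] (Fin n → ℝ) :=
  (Matrix.toLin' (A.map (fun z : ℤ => (z : ℝ)))).toAffineMap +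
    AffineMap.const ℝ _ (fun i => (b i : ℝ))

lemma uMap_coe {n : ℕ} (A : Matrix (Fin n) (Fin n) ℤ) (b : Fin n → ℤ) :
    ⇑(uMap A b) = (fun x : Fin n → ℝ => fun i => (∑ j, (A i j : ℝ) * x j) + (b i : ℝ)) := by
  ext x i
  simp [uMap, Matrix.mulVec, dotProduct]

lemma volume_uMap_image {n : ℕ} (A : Matrix (Fin n) (Fin n) ℤ) (b : Fin n → ℤ) :
    (volume (uMap A b '' stdSimplexSet n)).toReal =
      |(A.det : ℝ)| / (Nat.factorial n : ℝ) := by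
  have h1 : uMap A b '' stdSimplexSet n = (fun x => x + fun i => (b i : ℝ)) ''
      ((Matrix.toLin' (A.map (fun z : ℤ => (z : ℝ)))) '' stdSimplexSet n) := by
    rw [Set.image_image]
    apply Set.image_congr
    intro x _
    simp [uMap]
  rw [h1, Set.image_add_right, measure_preimage_add_right, Measure.addHaar_image_linearMap,
    volume_stdSimplexSet, LinearMap.det_toLin']
  have : (A.map (fun z : ℤ => (z : ℝ))).det = (A.det : ℝ) := by
    have := (Int.castRingHom ℝ).map_det A
    simpa [RingHom.mapMatrix_apply] using this.symm
  rw [this, ← ENNReal.ofReal_mul (abs_nonneg _), ENNReal.toReal_ofReal (by positivity)]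
  ring

/-- an enumerated lattice simplex is an affine image of the standard simplex -/
lemma convexHull_eq_uMap {n : ℕ} (p : Fin (n + 1) → (Fin n → ℤ)) :
    convexHull ℝ (Set.range fun k => fun i => (p k i : ℝ)) =
      uMap (Matrix.of fun i j => p j.succ i - p 0 i) (p 0) '' stdSimplexSet n := by
  rw [stdSimplexSet, AffineMap.image_convexHull, uMap_coe]
  congr 1
  ext x
  simp only [Set.image_insert_eq, Set.mem_insert_iff, Set.mem_range, Fin.exists_fin_succ,
    ← Set.range_comp]
  apply or_congr
  · simp [eq_comm]
  · apply exists_congr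
    intro k
    simp

def IsLat {n : ℕ} (x : Fin n → ℝ) : Prop := ∃ z : Fin n → ℤ, x = fun i => (z i : ℝ)

lemma exists_transc : ∃ t : ℝ, 0 < t ∧ t < 1 ∧ Transcendental ℚ t := by
  by_contra! h
  have : Set.Ioo (0:ℝ) 1 ⊆ {x | IsAlgebraic ℚ x} := by
    intro t ht
    have := h t ht.1 ht.2
    simpa [Transcendental] using this
  have hc := (Algebraic.countable ℚ ℝ).mono this
  have := (Cardinal.le_aleph0_iff_set_countable.mpr hc)
  rw [Cardinal.mk_Ioo_real zero_lt_one] at this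
  exact absurd this (not_le.mpr Cardinal.aleph0_lt_continuum)

lemma exists_height {n : ℕ} (A : Finset (Fin n → ℝ)) (hA : ∀ a ∈ A, IsLat a) :
    ∃ h : (Fin n → ℝ) → ℝ,
      (∀ w : (Fin n → ℝ) → ℚ, ∑ a ∈ A, (w a : ℝ) * h a = 0 → ∀ a ∈ A, w a = 0) ∧
      (∀ a ∈ A, ∃ l : (Fin n → ℝ) →ᵃ[ℝ] ℝ, l a = h a ∧ ∀ b ∈ A, l b ≤ h b) := by
  classical
  obtain ⟨t, ht0, ht1, htr⟩ := exists_transc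
  obtain ⟨k, hk⟩ : ∃ k : (Fin n → ℝ) → ℕ, Set.InjOn k A := by
    have : Set.Countable (A : Set (Fin n → ℝ)) := A.countable_toSet
    exact Set.countable_iff_exists_injOn.mp this
  choose! z hz using hA
  refine ⟨fun a => ∑ i, a i * a i + t ^ (k a + 1), ?_, ?_⟩
  · intro w hw a ha
    let P : Polynomial ℚ := Polynomial.C (∑ a ∈ A, w a * ∑ i, (z a i : ℚ) * z a i) +
      ∑ a ∈ A, Polynomial.monomial (k a + 1) (w a)
    have hP : Polynomial.aeval t P = 0 := by
      simp only [P, map_add, map_sum, Polynomial.aeval_C, Polynomial.aeval_monomial]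
      rw [← hw]
      simp only [mul_add, Finset.sum_add_distrib]
      congr 1
      simp only [map_mul, map_sum, eq_ratCast]
      apply Finset.sum_congr rfl
      intro b hb
      congr 1
      apply Finset.sum_congr rfl
      intro i _
      have := congrFun (hz b hb) i
      rw [this]; simp
    have hP0 : P = 0 := by
      by_contra h
      exact htr ⟨P, h, hP⟩
    have := congrArg (fun p => Polynomial.coeff p (k a + 1)) hP0
    simp only [P, Polynomial.coeff_add, Polynomial.coeff_C, Polynomial.finsetSum_coeff,
      Polynomial.coeff_monomial, Polynomial.coeff_zero] at this
    rw [if_neg (by omega), zero_add, Finset.sum_eq_single a] at this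
    · simpa using this
    · intro b hb hba
      rw [if_neg]
      intro h
      exact hba (hk hb ha (by omega))
    · intro h; exact absurd ha h
  · intro a ha
    let L : (Fin n → ℝ) →ₗ[ℝ] ℝ := ∑ i, (2 * a i) • LinearMap.proj i
    refine ⟨L.toAffineMap + AffineMap.const ℝ _ (t ^ (k a + 1) - ∑ i, a i * a i), ?_, ?_⟩
    · simp [L, Finset.sum_apply, mul_assoc, ← Finset.mul_sum]; ring
    · intro b hb
      have hL : L b = ∑ i, 2 * a i * b i := by simp [L]
      have e : ∑ i, b i * b i - (L b - ∑ i, a i * a i) = ∑ i, (b i - a i) ^ 2 := by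
        rw [hL, ← Finset.sum_sub_distrib, ← Finset.sum_sub_distrib]
        apply Finset.sum_congr rfl; intro i _; ring
      simp only [AffineMap.coe_add, LinearMap.coe_toAffineMap, AffineMap.coe_const, Pi.add_apply, Function.const_apply]
      by_cases hab : b = a
      · subst hab
        have : ∑ i, (b i - b i) ^ 2 = 0 := by simp
        linarith
      · have : 1 ≤ ∑ i, (b i - a i) ^ 2 := by
          have hs : ∑ i, (b i - a i) ^ 2 = ((∑ i, (z b i - z a i) ^ 2 : ℤ) : ℝ) := by
            push_cast
            apply Finset.sum_congr rfl; intro i _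
            rw [congrFun (hz a ha) i, congrFun (hz b hb) i]
          have hne : ∃ i, b i ≠ a i := by
            by_contra! h; exact hab (funext h)
          obtain ⟨i, hi⟩ := hne
          have hpos : 0 < ∑ i, (b i - a i) ^ 2 := by
            apply Finset.sum_pos' (fun i _ => sq_nonneg _)
            exact ⟨i, Finset.mem_univ _, by have := sub_ne_zero.mpr hi; positivity⟩
          rw [hs] at hpos ⊢
          exact_mod_cast hpos
        have h1 : t ^ (k a + 1) ≤ 1 := pow_le_one₀ ht0.le ht1.le
        have h2 : 0 ≤ t ^ (k b + 1) := by positivity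
        linarith

/-- contact sets have at most `n+1` points -/
lemma card_contact_le {n : ℕ} (A : Finset (Fin n → ℝ)) (hA : ∀ a ∈ A, IsLat a)
    (h : (Fin n → ℝ) → ℝ)
    (hh : ∀ w : (Fin n → ℝ) → ℚ, ∑ a ∈ A, (w a : ℝ) * h a = 0 → ∀ a ∈ A, w a = 0)
    (l : (Fin n → ℝ) →ᵃ[ℝ] ℝ) (B : Finset (Fin n → ℝ)) (hBA : B ⊆ A) (hB : ∀ b ∈ B, l b = h b) :
    B.card ≤ n + 1 := by
  classical
  choose! z hz using hA
  by_contra! hcard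
  let v : B → (Fin n → ℚ) × ℚ := fun b => (fun i => (z b i : ℚ), 1)
  have hnot : ¬ LinearIndependent ℚ v := by
    intro hli
    have := hli.fintype_card_le_finrank
    simp at this
    omega
  rw [Fintype.not_linearIndependent_iff] at hnot
  obtain ⟨g, hg, b0, hb0⟩ := hnot
  let w : (Fin n → ℝ) → ℚ := fun a => if ha : a ∈ B then g ⟨a, ha⟩ else 0
  have hsum : ∀ f : (Fin n → ℝ) → ℝ, ∑ a ∈ A, (w a : ℝ) * f a = ∑ b : B, (g b : ℝ) * f b := by
    intro f
    rw [← Finset.sum_subset hBA (f := fun a => (w a : ℝ) * f a)]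
    · rw [← Finset.sum_coe_sort]
      apply Finset.sum_congr rfl
      rintro ⟨b, hb⟩ _
      simp [w, hb]
    · intro a _ ha
      simp [w, ha]
  have := hh w ?_ b0 (hBA b0.2)
  · simp [w] at this; exact hb0 this
  · rw [hsum]
    have h1 : ∑ b : B, g b = 0 := by
      have := congrArg Prod.snd hg
      simpa [v, Prod.snd_sum] using this
    have h2 : ∑ b : B, (g b : ℝ) • (b : Fin n → ℝ) = 0 := by
      ext i
      have := congrFun (congrArg Prod.fst hg) i
      simp only [v, Prod.fst_sum, Finset.sum_apply, Prod.smul_mk, Pi.smul_apply, smul_eq_mul, Prod.fst_zero, Pi.zero_apply] at this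
      have h3 := congrArg (fun q : ℚ => (q : ℝ)) this
      simp only [Rat.cast_sum, Rat.cast_mul, Rat.cast_intCast, Rat.cast_zero] at h3
      rw [Finset.sum_apply, Pi.zero_apply, ← h3]
      apply Finset.sum_congr rfl
      rintro b _
      rw [Pi.smul_apply, smul_eq_mul, congrFun (hz b (hBA b.2)) i]
    have h1' : ∑ b : B, (g b : ℝ) = 0 := by exact_mod_cast congrArg (fun q : ℚ => (q : ℝ)) h1
    calc ∑ b : B, (g b : ℝ) * h b = ∑ b : B, (g b : ℝ) * (l.linear b + l 0) := by
          apply Finset.sum_congr rfl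
          intro b _
          rw [← hB b b.2]
          conv_lhs => rw [AffineMap.decomp l]
          simp
      _ = l.linear (∑ b : B, (g b : ℝ) • (b : Fin n → ℝ)) + (∑ b : B, (g b : ℝ)) * l 0 := by
          simp only [mul_add, Finset.sum_add_distrib, map_sum, map_smul, smul_eq_mul, Finset.sum_mul]
      _ = 0 := by rw [h2, h1']; simp

lemma affineMap_sum {n : ℕ} (l : (Fin n → ℝ) →ᵃ[ℝ] ℝ) (B : Finset (Fin n → ℝ))
    (w : (Fin n → ℝ) → ℝ) (hw : ∑ b ∈ B, w b = 1) :
    l (∑ b ∈ B, w b • b) = ∑ b ∈ B, w b * l b := by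
  have hd : ∀ x, l x = l.linear x + l 0 := fun x => by
    conv_lhs => rw [AffineMap.decomp l]
    simp
  rw [hd]
  calc _ = l.linear (∑ b ∈ B, w b • b) + (∑ b ∈ B, w b) * l 0 := by rw [hw, one_mul]
    _ = _ := by
      rw [map_sum, Finset.sum_mul, ← Finset.sum_add_distrib]
      apply Finset.sum_congr rfl
      intro b _
      rw [hd b, map_smul, smul_eq_mul]; ring

/-- growing the contact set -/
lemma exists_spanning_contact {n : ℕ} (A : Finset (Fin n → ℝ))
    (hspan : affineSpan ℝ (A : Set (Fin n → ℝ)) = ⊤) (h : (Fin n → ℝ) → ℝ)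
    (a : Fin n → ℝ) (ha : a ∈ A)
    (hl : ∃ l : (Fin n → ℝ) →ᵃ[ℝ] ℝ, l a = h a ∧ ∀ b ∈ A, l b ≤ h b) :
    ∃ (l : (Fin n → ℝ) →ᵃ[ℝ] ℝ) (B : Finset (Fin n → ℝ)), B ⊆ A ∧ a ∈ B ∧
      (∀ b ∈ B, l b = h b) ∧ (∀ b ∈ A, b ∉ B → l b < h b) ∧
      affineSpan ℝ (B : Set (Fin n → ℝ)) = ⊤ := by
  classical
  let F : Finset (Finset (Fin n → ℝ)) := A.powerset.filter fun B => a ∈ B ∧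
    ∃ l : (Fin n → ℝ) →ᵃ[ℝ] ℝ, (∀ b ∈ B, l b = h b) ∧ (∀ b ∈ A, b ∉ B → l b < h b)
  have hmemF : ∀ l : (Fin n → ℝ) →ᵃ[ℝ] ℝ, l a = h a → (∀ b ∈ A, l b ≤ h b) →
      A.filter (fun b => l b = h b) ∈ F := by
    intro l h1 h2
    simp only [F, Finset.mem_filter, Finset.mem_powerset]
    refine ⟨Finset.filter_subset _ _, ⟨ha, h1⟩, l, fun b hb => hb.2, ?_⟩
    intro b hb hb'
    exact lt_of_le_of_ne (h2 b hb) fun he => hb' ⟨hb, he⟩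
  obtain ⟨l0, h01, h02⟩ := hl
  obtain ⟨B, hBF, hBmax⟩ := F.exists_max_image Finset.card ⟨_, hmemF l0 h01 h02⟩
  have hBF' := hBF
  simp only [F, Finset.mem_filter, Finset.mem_powerset] at hBF'
  obtain ⟨hBA, haB, l, hlB, hlt⟩ := hBF'
  refine ⟨l, B, hBA, haB, hlB, hlt, ?_⟩
  by_contra hne
  -- a linear functional constant on `B`
  have hdir : (affineSpan ℝ (B : Set (Fin n → ℝ))).direction < ⊤ := by
    rw [lt_top_iff_ne_top]
    intro hd
    apply hne
    rwa [AffineSubspace.direction_eq_top_iff_of_nonempty] at hd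
    exact ⟨a, subset_affineSpan ℝ _ (by exact_mod_cast haB)⟩
  obtain ⟨f, hf0, hfk⟩ := Submodule.exists_le_ker_of_lt_top _ hdir
  have hfB : ∀ b ∈ B, f b = f a := by
    intro b hb
    have : b -ᵥ a ∈ (affineSpan ℝ (B : Set (Fin n → ℝ))).direction :=
      AffineSubspace.vsub_mem_direction (subset_affineSpan ℝ _ (by exact_mod_cast hb))
        (subset_affineSpan ℝ _ (by exact_mod_cast haB))
    have := hfk this
    simp only [LinearMap.mem_ker, vsub_eq_sub, map_sub] at this
    linarith
  have hfA : ∃ b ∈ A, f b ≠ f a := by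
    by_contra! hall
    apply hf0
    have hle : vectorSpan ℝ (A : Set (Fin n → ℝ)) ≤ LinearMap.ker f := by
      rw [vectorSpan, Submodule.span_le]
      rintro _ ⟨x, hx, y, hy, rfl⟩
      simp [hall x hx, hall y hy]
    have : vectorSpan ℝ (A : Set (Fin n → ℝ)) = ⊤ := by
      rw [← direction_affineSpan, hspan, AffineSubspace.direction_top]
    rw [this, top_le_iff, LinearMap.ker_eq_top] at hle
    exact hle
  obtain ⟨f, hfB, b1, hb1, hb1'⟩ : ∃ f : (Fin n → ℝ) →ₗ[ℝ] ℝ, (∀ b ∈ B, f b = f a) ∧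
      ∃ b ∈ A, f a < f b := by
    obtain ⟨b, hb, hb'⟩ := hfA
    rcases lt_or_gt_of_ne hb' with hlt | hgt
    · exact ⟨-f, fun b hb => by simp [hfB b hb], b, hb, by simpa using hlt⟩
    · exact ⟨f, hfB, b, hb, hgt⟩
  let P := A.filter fun b => f a < f b
  let q : (Fin n → ℝ) → ℝ := fun b => (h b - l b) / (f b - f a)
  obtain ⟨c, hcP, hcmin⟩ := P.exists_min_image q ⟨b1, by simp [P, hb1, hb1']⟩
  have hcA : c ∈ A := (Finset.mem_filter.mp hcP).1
  have hcf : f a < f c := (Finset.mem_filter.mp hcP).2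
  have hcB : c ∉ B := fun hc => by rw [hfB c hc] at hcf; exact lt_irrefl _ hcf
  have hq0 : 0 < q c := div_pos (by linarith [hlt c hcA hcB]) (by linarith)
  let l' : (Fin n → ℝ) →ᵃ[ℝ] ℝ := l + (q c) • (f.toAffineMap - AffineMap.const ℝ _ (f a))
  have hl' : ∀ x, l' x = l x + q c * (f x - f a) := by intro x; simp [l']
  have hB'F := hmemF l' (by rw [hl', hlB a haB]; simp) (by
    intro b hb
    rw [hl']
    by_cases hbP : f a < f b
    · have := hcmin b (by simp [P, hb, hbP])
      have h2 : q b * (f b - f a) = h b - l b := by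
        simp only [q]; field_simp [sub_ne_zero.mpr hbP.ne']
      nlinarith
    · have hb2 : l b ≤ h b := by
        by_cases hbB : b ∈ B
        · exact (hlB b hbB).le
        · exact (hlt b hb hbB).le
      push Not at hbP
      nlinarith)
  have hlt2 : B.card < (A.filter (fun b => l' b = h b)).card := by
    apply Finset.card_lt_card
    rw [Finset.ssubset_iff_of_subset]
    · refine ⟨c, ?_, hcB⟩
      simp only [Finset.mem_filter]
      refine ⟨hcA, ?_⟩
      rw [hl']
      have : f c - f a ≠ 0 := by linarith
      simp only [q]; field_simp; ring
    · intro b hb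
      simp only [Finset.mem_filter]
      refine ⟨hBA hb, ?_⟩
      rw [hl', hlB b hb, hfB b hb]; simp
  exact absurd (hBmax _ hB'F) (not_le.mpr hlt2)

lemma card_ge_of_span {n : ℕ} (B : Finset (Fin n → ℝ))
    (hspan : affineSpan ℝ (B : Set (Fin n → ℝ)) = ⊤) : n + 1 ≤ B.card := by
  classical
  have hne : B.Nonempty := by
    rw [Finset.nonempty_iff_ne_empty]
    rintro rfl
    simp at hspan
  obtain ⟨m, hm⟩ : ∃ m, B.card = m + 1 := ⟨B.card - 1, by have := hne.card_pos; omega⟩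
  have := finrank_vectorSpan_image_finset_le ℝ (id : (Fin n → ℝ) → (Fin n → ℝ)) B hm
  rw [Finset.image_id, ← direction_affineSpan, hspan, AffineSubspace.direction_top] at this
  simp at this
  omega

lemma inter_aux {n : ℕ} (A : Finset (Fin n → ℝ)) (h : (Fin n → ℝ) → ℝ)
    (B B' : Finset (Fin n → ℝ)) (hBA : B ⊆ A) 
    (l' : (Fin n → ℝ) →ᵃ[ℝ] ℝ) (hB' : ∀ b ∈ B', l' b = h b)
    (hlt : ∀ b ∈ A, b ∉ B' → l' b < h b) (b : Fin n → ℝ) (hb : b ∈ B) : l' b ≤ h b := by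
  by_cases hbB : b ∈ B'
  · exact (hB' b hbB).le
  · exact (hlt b (hBA hb) hbB).le

lemma exists_triang {n : ℕ} (A : Finset (Fin n → ℝ)) (hA : ∀ a ∈ A, IsLat a)
    (hspan : affineSpan ℝ (A : Set (Fin n → ℝ)) = ⊤) :
    ∃ T : Finset (Finset (Fin n → ℝ)),
      (∀ B ∈ T, B ⊆ A ∧ B.card = n + 1 ∧ affineSpan ℝ (B : Set (Fin n → ℝ)) = ⊤) ∧
      (∀ a ∈ A, ∃ B ∈ T, a ∈ B) ∧
      (∀ B ∈ T, ∀ B' ∈ T, ∀ x ∈ convexHull ℝ (B : Set (Fin n → ℝ)),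
        x ∈ convexHull ℝ (B' : Set (Fin n → ℝ)) →
        x ∈ convexHull ℝ ((B : Set (Fin n → ℝ)) ∩ B')) := by
  classical
  obtain ⟨h, hgen, hex⟩ := exists_height A hA
  refine ⟨A.powerset.filter fun B => affineSpan ℝ (B : Set (Fin n → ℝ)) = ⊤ ∧
    ∃ l : (Fin n → ℝ) →ᵃ[ℝ] ℝ, (∀ b ∈ B, l b = h b) ∧ (∀ b ∈ A, b ∉ B → l b < h b), ?_, ?_, ?_⟩
  · intro B hB
    simp only [Finset.mem_filter, Finset.mem_powerset] at hB
    obtain ⟨hBA, hs, l, h1, h2⟩ := hB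
    exact ⟨hBA, le_antisymm (card_contact_le A hA h hgen l B hBA h1) (card_ge_of_span B hs), hs⟩
  · intro a ha
    obtain ⟨l, B, hBA, haB, h1, h2, h3⟩ := exists_spanning_contact A hspan h a ha (hex a ha)
    exact ⟨B, by simp only [Finset.mem_filter, Finset.mem_powerset]; exact ⟨hBA, h3, l, h1, h2⟩, haB⟩
  · intro B hB B' hB' x hx hx'
    simp only [Finset.mem_filter, Finset.mem_powerset] at hB hB'
    obtain ⟨hBA, hs, l, h1, h2⟩ := hB
    obtain ⟨hBA', hs', l', h1', h2'⟩ := hB'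
    rw [Finset.mem_convexHull'] at hx hx'
    obtain ⟨w, hw0, hw1, rfl⟩ := hx
    obtain ⟨w', hw0', hw1', hx'⟩ := hx'
    have e1 := affineMap_sum l B w hw1
    have e2 := affineMap_sum l' B w hw1
    have e3 := affineMap_sum l B' w' hw1'
    have e4 := affineMap_sum l' B' w' hw1'
    rw [hx'] at e3 e4
    have i2 : ∀ b ∈ B, w b * l' b ≤ w b * l b := fun b hb => by
      rw [h1 b hb]
      exact mul_le_mul_of_nonneg_left (inter_aux A h B B' hBA l' h1' h2' b hb) (hw0 b hb)
    have i3 : ∀ b ∈ B', w' b * l b ≤ w' b * l' b := fun b hb => by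
      rw [h1' b hb]
      exact mul_le_mul_of_nonneg_left (inter_aux A h B' B hBA' l h1 h2 b hb) (hw0' b hb)
    have heq : ∑ b ∈ B, w b * l' b = ∑ b ∈ B, w b * l b := by
      apply le_antisymm (Finset.sum_le_sum i2)
      rw [← e1, ← e2, e3, e4]
      exact Finset.sum_le_sum i3
    rw [Finset.sum_eq_sum_iff_of_le i2] at heq
    have hz : ∀ b ∈ B, b ∉ B' → w b = 0 := by
      intro b hb hb'
      have := heq b hb
      rw [h1 b hb] at this
      have hlt := h2' b (hBA hb) hb'
      by_contra hne
      exact hlt.ne (mul_left_cancel₀ hne this)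
    rw [← Finset.coe_inter, Finset.mem_convexHull']
    refine ⟨w, fun b hb => hw0 b (Finset.mem_inter.mp hb).1, ?_, ?_⟩
    · rw [← hw1]
      apply Finset.sum_subset Finset.inter_subset_left
      intro b hb hb'
      exact hz b hb fun h => hb' (Finset.mem_inter.mpr ⟨hb, h⟩)
    · apply Finset.sum_subset Finset.inter_subset_left
      intro b hb hb'
      rw [hz b hb fun h => hb' (Finset.mem_inter.mpr ⟨hb, h⟩), zero_smul]

lemma simplex_form {n : ℕ} (B : Finset (Fin n → ℝ)) (hB : ∀ b ∈ B, IsLat b)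
    (hc : B.card = n + 1) (hs : affineSpan ℝ (B : Set (Fin n → ℝ)) = ⊤) :
    ∃ (M : Matrix (Fin n) (Fin n) ℤ) (b : Fin n → ℤ), M.det ≠ 0 ∧
      convexHull ℝ (B : Set (Fin n → ℝ)) = uMap M b '' stdSimplexSet n := by
  classical
  let e := (B.equivFinOfCardEq hc).symm
  choose! z hz using hB
  have hr : (B : Set (Fin n → ℝ)) = Set.range fun k => fun i => ((z (e k) i : ℤ) : ℝ) := by
    ext x
    constructor
    · intro hx
      refine ⟨e.symm ⟨x, hx⟩, ?_⟩
      simp only [Equiv.apply_symm_apply]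
      exact (hz x hx).symm
    · rintro ⟨k, rfl⟩
      show (fun i => ((z (e k) i : ℤ) : ℝ)) ∈ (B : Set (Fin n → ℝ))
      rw [← hz _ (e k).2]
      exact (e k).2
  have hform := convexHull_eq_uMap (fun k => z (e k))
  rw [← hr] at hform
  refine ⟨_, _, ?_, hform⟩
  intro hdet
  have hint : (interior (convexHull ℝ (B : Set (Fin n → ℝ)))).Nonempty :=
    interior_convexHull_nonempty_iff_affineSpan_eq_top.mpr hs
  have hpos := Measure.measure_pos_of_nonempty_interior volume hint
  have hcomp : IsCompact (convexHull ℝ (B : Set (Fin n → ℝ))) :=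
    B.finite_toSet.isCompact_convexHull (𝕜 := ℝ)
  have h1 := ENNReal.toReal_pos hpos.ne' hcomp.measure_lt_top.ne
  rw [hform, volume_uMap_image, hdet] at h1
  simp at h1

lemma volume_ge {n : ℕ} (B : Finset (Fin n → ℝ)) (hB : ∀ b ∈ B, IsLat b)
    (hc : B.card = n + 1) (hs : affineSpan ℝ (B : Set (Fin n → ℝ)) = ⊤) :
    1 / (Nat.factorial n : ℝ) ≤ (volume (convexHull ℝ (B : Set (Fin n → ℝ)))).toReal := by
  obtain ⟨M, b, hM, h⟩ := simplex_form B hB hc hs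
  rw [h, volume_uMap_image]
  have : (1 : ℝ) ≤ |(M.det : ℝ)| := by exact_mod_cast Int.one_le_abs hM
  gcongr

/-- the finite set of lattice points -/
lemma exists_latticePts (n : ℕ) (V : Finset (Fin n → ℤ)) (Q : Set (Fin n → ℝ))
    (hQ : Q = convexHull ℝ ((fun v : Fin n → ℤ => fun i => (v i : ℝ)) '' V))
    (hfull : (interior Q).Nonempty) :
    ∃ A : Finset (Fin n → ℝ), (∀ x, x ∈ A ↔ x ∈ Q ∧ IsLat x) ∧
      A.card = Nat.card {x : Fin n → ℤ // (fun i => (x i : ℝ)) ∈ Q} ∧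
      affineSpan ℝ (A : Set (Fin n → ℝ)) = ⊤ := by
  classical
  let c : (Fin n → ℤ) → (Fin n → ℝ) := fun v i => (v i : ℝ)
  have hcinj : Function.Injective c := by
    intro x y hxy
    ext i
    have : (x i : ℝ) = (y i : ℝ) := congrFun hxy i
    exact_mod_cast this
  have hcomp : IsCompact Q := by
    rw [hQ]; exact (V.finite_toSet.image _).isCompact_convexHull (𝕜 := ℝ)
  have hfin : (c ⁻¹' Q).Finite := by
    obtain ⟨R, hR⟩ := hcomp.isBounded.subset_closedBall 0
    apply (Set.finite_Icc (fun _ : Fin n => -⌈R⌉) (fun _ => ⌈R⌉)).subset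
    intro z hz
    have h1 := hR hz
    rw [mem_closedBall_zero_iff] at h1
    have h2 : ∀ i, |(z i : ℝ)| ≤ R := fun i => by
      have := (norm_le_pi_norm (c z) i).trans h1
      simpa [c] using this
    constructor
    · intro i
      have := neg_le_of_abs_le (h2 i)
      have h3 := Int.le_ceil R
      have : (-⌈R⌉ : ℝ) ≤ z i := by linarith
      exact_mod_cast this
    · intro i
      have := le_of_abs_le (h2 i)
      have h3 := Int.le_ceil R
      have : (z i : ℝ) ≤ ⌈R⌉ := by linarith
      exact_mod_cast this
  have hmem : ∀ x, x ∈ hfin.toFinset.image c ↔ x ∈ Q ∧ IsLat x := by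
    intro x
    simp only [Finset.mem_image, Set.Finite.mem_toFinset, Set.mem_preimage, IsLat]
    constructor
    · rintro ⟨z, hz, rfl⟩; exact ⟨hz, z, rfl⟩
    · rintro ⟨hx, z, rfl⟩; exact ⟨z, hx, rfl⟩
  refine ⟨hfin.toFinset.image c, hmem, ?_, ?_⟩
  · rw [Finset.card_image_of_injective _ hcinj]
    rw [← Set.ncard_eq_toFinset_card _ hfin]
    rfl
  · rw [eq_top_iff]
    rw [hQ, interior_convexHull_nonempty_iff_affineSpan_eq_top] at hfull
    rw [← hfull]
    apply affineSpan_mono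
    rintro x ⟨v, hv, rfl⟩
    rw [Finset.mem_coe, hmem]
    refine ⟨?_, v, rfl⟩
    rw [hQ]
    exact subset_convexHull ℝ _ ⟨v, hv, rfl⟩

structure TriData (n : ℕ) (A : Finset (Fin n → ℝ)) (Q : Set (Fin n → ℝ))
    (T : Finset (Finset (Fin n → ℝ))) : Prop where
  sub : ∀ B ∈ T, B ⊆ A ∧ B.card = n + 1 ∧ affineSpan ℝ (B : Set (Fin n → ℝ)) = ⊤
  inter : ∀ B ∈ T, ∀ B' ∈ T, ∀ x ∈ convexHull ℝ (B : Set (Fin n → ℝ)),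
        x ∈ convexHull ℝ (B' : Set (Fin n → ℝ)) →
        x ∈ convexHull ℝ ((B : Set (Fin n → ℝ)) ∩ B')
  eqU : A = T.biUnion id
  vol : (volume (⋃ B ∈ T, convexHull ℝ (B : Set (Fin n → ℝ)))).toReal =
    ∑ B ∈ T, (volume (convexHull ℝ (B : Set (Fin n → ℝ)))).toReal
  subQ : (⋃ B ∈ T, convexHull ℝ (B : Set (Fin n → ℝ))) ⊆ Q
  low : (T.card : ℝ) * (1 / (Nat.factorial n : ℝ)) ≤
    (volume (⋃ B ∈ T, convexHull ℝ (B : Set (Fin n → ℝ)))).toReal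
  card : A.card ≤ T.card * (n + 1)

lemma exists_triData {n : ℕ} (A : Finset (Fin n → ℝ)) (Q : Set (Fin n → ℝ))
    (hQc : Convex ℝ Q) (hAQ : ∀ x ∈ A, x ∈ Q ∧ IsLat x)
    (hspan : affineSpan ℝ (A : Set (Fin n → ℝ)) = ⊤) : ∃ T, TriData n A Q T := by
  classical
  obtain ⟨T, h1, h2, h3⟩ := exists_triang A (fun a ha => (hAQ a ha).2) hspan
  have hU : A = T.biUnion id := by
    ext a
    simp only [Finset.mem_biUnion, id]
    exact ⟨h2 a, fun ⟨B, hB, haB⟩ => (h1 B hB).1 haB⟩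
  have hcomp : ∀ B : Finset (Fin n → ℝ), IsCompact (convexHull ℝ (B : Set (Fin n → ℝ))) :=
    fun B => B.finite_toSet.isCompact_convexHull (𝕜 := ℝ)
  have hvol : (volume (⋃ B ∈ T, convexHull ℝ (B : Set (Fin n → ℝ)))).toReal =
      ∑ B ∈ T, (volume (convexHull ℝ (B : Set (Fin n → ℝ)))).toReal := by
    rw [measure_biUnion_finset₀, ENNReal.toReal_sum]
    · intro B _; exact (hcomp B).measure_lt_top.ne
    · intro B hB B' hB' hne
      refine measure_mono_null (t := (affineSpan ℝ ((B ∩ B' : Finset (Fin n → ℝ)) : Set (Fin n → ℝ)) : Set (Fin n → ℝ))) ?_ ?_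
      · rintro x ⟨hx, hx'⟩
        have := h3 B hB B' hB' x hx hx'
        rw [Finset.coe_inter]
        exact convexHull_subset_affineSpan _ this
      · apply Measure.addHaar_affineSubspace
        intro htop
        have hge := card_ge_of_span _ htop
        have hBB : B ∩ B' = B := Finset.eq_of_subset_of_card_le Finset.inter_subset_left
          (by rw [(h1 B hB).2.1]; exact hge)
        have hBB' : B ∩ B' = B' := Finset.eq_of_subset_of_card_le Finset.inter_subset_right
          (by rw [(h1 B' hB').2.1]; exact hge)
        exact hne (hBB.symm.trans hBB')
    · intro B _; exact (hcomp B).measurableSet.nullMeasurableSet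
  refine ⟨T, h1, h3, hU, hvol, ?_, ?_, ?_⟩
  · refine Set.iUnion₂_subset fun B hB => convexHull_min ?_ hQc
    intro x hx
    exact (hAQ x ((h1 B hB).1 hx)).1
  · rw [hvol, ← nsmul_eq_mul]
    apply Finset.card_nsmul_le_sum
    intro B hB
    exact volume_ge B (fun b hb => (hAQ b ((h1 B hB).1 hb)).2) (h1 B hB).2.1 (h1 B hB).2.2
  · rw [hU]
    apply Finset.card_biUnion_le_card_mul
    intro B hB
    exact (h1 B hB).2.1.le

lemma TriData.upper {n : ℕ} {A : Finset (Fin n → ℝ)} {Q : Set (Fin n → ℝ)}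
    {T : Finset (Finset (Fin n → ℝ))} (hT : TriData n A Q T) (hQ : IsCompact Q) :
    (A.card : ℝ) ≤ (Nat.factorial (n + 1) : ℝ) * (volume Q).toReal := by
  have h1 : (volume (⋃ B ∈ T, convexHull ℝ (B : Set (Fin n → ℝ)))).toReal ≤ (volume Q).toReal :=
    ENNReal.toReal_mono hQ.measure_lt_top.ne (measure_mono hT.subQ)
  have h2 := hT.low.trans h1
  have h3 : (A.card : ℝ) ≤ T.card * (n + 1) := by exact_mod_cast hT.card
  have hf : (0 : ℝ) < Nat.factorial n := by positivity
  rw [mul_one_div, div_le_iff₀ hf] at h2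
  rw [Nat.factorial_succ]
  push_cast
  nlinarith

/-- the equality case -/
lemma TriData.equality {n : ℕ} {A : Finset (Fin n → ℝ)} {Q : Set (Fin n → ℝ)}
    {T : Finset (Finset (Fin n → ℝ))} (hT : TriData n A Q T) (hQ : IsCompact Q)
    (hQc : Convex ℝ Q) (hfull : (interior Q).Nonempty)
    (heq : (A.card : ℝ) = (Nat.factorial (n + 1) : ℝ) * (volume Q).toReal) :
    ∃ B ∈ T, Q = convexHull ℝ (B : Set (Fin n → ℝ)) ∧
      (volume Q).toReal = 1 / (Nat.factorial n : ℝ) := by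
  classical
  set U := ⋃ B ∈ T, convexHull ℝ (B : Set (Fin n → ℝ)) with hUdef
  have hcomp : ∀ B : Finset (Fin n → ℝ), IsCompact (convexHull ℝ (B : Set (Fin n → ℝ))) :=
    fun B => B.finite_toSet.isCompact_convexHull (𝕜 := ℝ)
  have h1 : (volume U).toReal ≤ (volume Q).toReal :=
    ENNReal.toReal_mono hQ.measure_lt_top.ne (measure_mono hT.subQ)
  have h2 := hT.low
  have h3 : (A.card : ℝ) ≤ T.card * (n + 1) := by exact_mod_cast hT.card
  have hf : (0 : ℝ) < Nat.factorial n := by positivity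
  rw [← hUdef, mul_one_div, div_le_iff₀ hf] at h2
  rw [Nat.factorial_succ] at heq
  push_cast at heq
  have hn : (0 : ℝ) < n + 1 := by positivity
  have hvolU : (volume U).toReal = (volume Q).toReal := by
    apply le_antisymm h1
    by_contra! hlt
    have : (volume U).toReal * (Nat.factorial n * (n + 1)) < (volume Q).toReal * (Nat.factorial n * (n + 1)) :=
      mul_lt_mul_of_pos_right hlt (by positivity)
    nlinarith
  have hTc : (T.card : ℝ) = (volume Q).toReal * Nat.factorial n := by
    apply le_antisymm
    · rw [← hvolU]; exact h2
    · have : ((volume Q).toReal * Nat.factorial n) * (n + 1) ≤ T.card * (n + 1) := by nlinarith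
      exact le_of_mul_le_mul_right this hn
  have hcardeq : A.card = T.card * (n + 1) := by
    have : (A.card : ℝ) = T.card * (n + 1) := by rw [heq, hTc]; ring
    exact_mod_cast this
  -- pairwise disjointness
  have hdisj : ∀ B ∈ T, ∀ B' ∈ T, B ≠ B' → Disjoint B B' := by
    intro B hB B' hB' hne
    rw [Finset.disjoint_left]
    intro a haB haB'
    have hA' : A ⊆ (T.erase B).biUnion id ∪ (B.erase a) := by
      intro x hx
      rw [hT.eqU] at hx
      simp only [Finset.mem_biUnion, id] at hx
      obtain ⟨C, hC, hxC⟩ := hx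
      simp only [Finset.mem_union, Finset.mem_biUnion, id, Finset.mem_erase]
      by_cases hCB : C = B
      · subst hCB
        by_cases hxa : x = a
        · subst hxa
          exact Or.inl ⟨B', ⟨hne.symm, hB'⟩, haB'⟩
        · exact Or.inr ⟨hxa, hxC⟩
      · exact Or.inl ⟨C, ⟨hCB, hC⟩, hxC⟩
    have hle := (Finset.card_le_card hA').trans (Finset.card_union_le _ _)
    have hle2 : ((T.erase B).biUnion id).card ≤ (T.erase B).card * (n + 1) := by
      apply Finset.card_biUnion_le_card_mul
      intro C hC
      exact (hT.sub C (Finset.mem_of_mem_erase hC)).2.1.le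
    have hb : (B.erase a).card = n := by
      rw [Finset.card_erase_of_mem haB, (hT.sub B hB).2.1]; simp
    have ht : (T.erase B).card + 1 = T.card := Finset.card_erase_add_one hB
    rw [hcardeq, ← ht, add_mul] at hle
    omega
  -- covering
  have hUcl : IsClosed U := T.finite_toSet.isClosed_biUnion fun B _ => (hcomp B).isClosed
  have hQU : Q ⊆ U := by
    have hnull : volume (interior Q \ U) = 0 := by
      refine measure_mono_null (Set.sdiff_subset_sdiff_left interior_subset) ?_
      rw [measure_sdiff hT.subQ hUcl.measurableSet.nullMeasurableSet
        ((measure_mono hT.subQ).trans_lt hQ.measure_lt_top).ne]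
      rw [(ENNReal.toReal_eq_toReal_iff' ((measure_mono hT.subQ).trans_lt hQ.measure_lt_top).ne
        hQ.measure_lt_top.ne).mp hvolU]
      simp
    have hopen : IsOpen (interior Q \ U) := isOpen_interior.sdiff hUcl
    have hemp := (hopen.measure_eq_zero_iff volume).mp hnull
    have hsub : interior Q ⊆ U := Set.sdiff_eq_empty.mp hemp
    calc Q ⊆ closure Q := subset_closure
      _ = closure (interior Q) := (hQc.closure_interior_eq_closure_of_nonempty_interior hfull).symm
      _ ⊆ U := hUcl.closure_subset_iff.mpr hsub
  obtain ⟨q, hq⟩ := hfull.mono interior_subset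
  have hqU := hQU hq
  simp only [hUdef, Set.mem_iUnion] at hqU
  obtain ⟨B, hB, hqB⟩ := hqU
  have hBQ : convexHull ℝ (B : Set (Fin n → ℝ)) ⊆ Q :=
    (Set.subset_biUnion_of_mem (u := fun B : Finset (Fin n → ℝ) => convexHull ℝ (B : Set (Fin n → ℝ))) hB).trans hT.subQ
  have honly : ∀ B' ∈ T, B' = B := by
    by_contra! hex
    obtain ⟨B', hB', hne⟩ := hex
    have hpre := isPreconnected_closed_iff.mp hQc.isPreconnected
      (convexHull ℝ (B : Set (Fin n → ℝ)))
      (⋃ C ∈ T.erase B, convexHull ℝ (C : Set (Fin n → ℝ)))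
      (hcomp B).isClosed ((T.erase B).finite_toSet.isClosed_biUnion fun C _ => (hcomp C).isClosed)
      ?_ ⟨q, hq, hqB⟩ ?_
    · obtain ⟨x, _, hxB, hxC⟩ := hpre
      simp only [Set.mem_iUnion, Finset.mem_erase] at hxC
      obtain ⟨C, ⟨hCB, hC⟩, hxC⟩ := hxC
      have := hT.inter B hB C hC x hxB hxC
      rw [← Finset.coe_inter, Finset.disjoint_iff_inter_eq_empty.mp (hdisj B hB C hC (Ne.symm hCB))] at this
      simp at this
    · intro x hx
      have := hQU hx
      simp only [hUdef, Set.mem_iUnion] at this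
      obtain ⟨C, hC, hxC⟩ := this
      by_cases hCB : C = B
      · subst hCB; exact Or.inl hxC
      · refine Or.inr ?_
        simp only [Set.mem_iUnion, Finset.mem_erase]
        exact ⟨C, ⟨hCB, hC⟩, hxC⟩
    · have hne' : B'.Nonempty := by
        rw [← Finset.card_pos, (hT.sub B' hB').2.1]; omega
      obtain ⟨b, hb⟩ := hne'
      have hbc : b ∈ convexHull ℝ (B' : Set (Fin n → ℝ)) := subset_convexHull ℝ _ hb
      refine ⟨b, hT.subQ ?_, ?_⟩
      · simp only [hUdef, Set.mem_iUnion]; exact ⟨B', hB', hbc⟩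
      · simp only [Set.mem_iUnion, Finset.mem_erase]
        exact ⟨B', ⟨hne, hB'⟩, hbc⟩
  have hT1 : T = {B} := Finset.eq_singleton_iff_unique_mem.mpr ⟨hB, honly⟩
  refine ⟨B, hB, Set.Subset.antisymm ?_ hBQ, ?_⟩
  · have : U = convexHull ℝ (B : Set (Fin n → ℝ)) := by simp [hUdef, hT1]
    rw [← this]; exact hQU
  · rw [hT1] at hTc
    simp at hTc
    rw [eq_div_iff hf.ne']; exact hTc.symm

/-- the `n+1` vertices of a unimodular simplex -/
lemma card_ge_of_unimod {n : ℕ} (M : Matrix (Fin n) (Fin n) ℤ) (b : Fin n → ℤ)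
    (hs : (interior (uMap M b '' stdSimplexSet n)).Nonempty) (A : Finset (Fin n → ℝ))
    (hA : ∀ x, x ∈ A ↔ x ∈ uMap M b '' stdSimplexSet n ∧ IsLat x) : n + 1 ≤ A.card := by
  apply card_ge_of_span
  rw [eq_top_iff]
  rw [stdSimplexSet, AffineMap.image_convexHull,
    interior_convexHull_nonempty_iff_affineSpan_eq_top] at hs
  rw [← hs]
  apply affineSpan_mono
  rintro _ ⟨y, hy, rfl⟩
  rw [Finset.mem_coe, hA]
  refine ⟨⟨y, subset_convexHull ℝ _ hy, rfl⟩, ?_⟩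
  rw [uMap_coe]
  rcases hy with rfl | ⟨k, rfl⟩
  · exact ⟨b, by ext i; simp⟩
  · exact ⟨fun i => M i k + b i, by ext i; simp⟩

/-- equality Card(Q ∩ ℤ^n) = (n+1)!·Vol(Q) holds iff Q is unimodularly
equivalent to the standard n-simplex. -/
theorem lattice_point_count_eq_iff (n : ℕ) (V : Finset (Fin n → ℤ)) (Q : Set (Fin n → ℝ))
    (hQ : Q = convexHull ℝ ((fun v : Fin n → ℤ => fun i => (v i : ℝ)) '' V))
    (hfull : (interior Q).Nonempty) :
    (Nat.card {x : Fin n → ℤ // (fun i => (x i : ℝ)) ∈ Q} : ℝ) =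
      (Nat.factorial (n + 1) : ℝ) * (volume Q).toReal ↔ UnimodEquivStdSimplex n Q := by
  obtain ⟨A, hmem, hcard, hspan⟩ := exists_latticePts n V Q hQ hfull
  have hcomp : IsCompact Q := by
    rw [hQ]; exact (V.finite_toSet.image _).isCompact_convexHull (𝕜 := ℝ)
  have hconv : Convex ℝ Q := by rw [hQ]; exact convex_convexHull ℝ _
  obtain ⟨T, hT⟩ := exists_triData A Q hconv (fun x hx => (hmem x).mp hx) hspan
  have hf : (0 : ℝ) < Nat.factorial n := by positivity
  rw [← hcard]
  constructor
  · intro heq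
    obtain ⟨B, hB, hQB, hvol⟩ := hT.equality hcomp hconv hfull heq
    obtain ⟨hBA, hBc, hBs⟩ := hT.sub B hB
    obtain ⟨M, b, hM, hform⟩ := simplex_form B (fun x hx => ((hmem x).mp (hBA hx)).2) hBc hBs
    refine ⟨M, b, ?_, ?_⟩
    · rw [hQB, hform, volume_uMap_image, div_left_inj' hf.ne'] at hvol
      have : |M.det| = 1 := by exact_mod_cast hvol
      rw [Int.isUnit_iff_abs_eq]; exact this
    · rw [← uMap_coe, hQB, hform]
  · rintro ⟨M, b, hM, hform⟩
    rw [← uMap_coe] at hform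
    apply le_antisymm (hT.upper hcomp)
    have h1 : n + 1 ≤ A.card := by
      apply card_ge_of_unimod M b
      · rw [← hform]; exact hfull
      · rw [← hform]; exact hmem
    have hdet : |(M.det : ℝ)| = 1 := by
      have := Int.isUnit_iff_abs_eq.mp hM
      exact_mod_cast this
    rw [hform, volume_uMap_image, hdet, Nat.factorial_succ]
    push_cast
    rw [mul_assoc, mul_one_div_cancel hf.ne', mul_one]
    exact_mod_cast h1
end

section
/- All entries of the Ehrhart h*-vector of a full-dimensional lattice polytope are nonnegative integers (Stanley nonnegativity). -/
open MeasureTheory Pointwise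

theorem aux_generic {ι J : Type*} [Fintype ι] [Finite J] (c : J → ι → ℝ) (hc : ∀ j, c j ≠ 0) :
    ∃ μ : ι → ℝ, (∀ i, 0 < μ i) ∧ ∀ j, ∑ i, c j i * μ i ≠ 0 := by
  classical
  have := Fintype.ofFinite J
  let e := Fintype.equivFin ι
  let P : J → Polynomial ℝ := fun j => ∑ i, Polynomial.monomial (e i : ℕ) (c j i)
  have hP : ∀ j, P j ≠ 0 := by
    intro j h0
    apply hc j
    funext i
    have h1 : (P j).coeff (e i) = c j i := by
      simp only [P, Polynomial.finsetSum_coeff, Polynomial.coeff_monomial]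
      rw [Finset.sum_eq_single i]
      · simp
      · intro b _ hb
        rw [if_neg]
        intro hh
        exact hb (e.injective (Fin.ext hh))
      · simp
    rw [h0] at h1
    simpa using h1.symm
  have hprod : ∏ j, P j ≠ 0 := Finset.prod_ne_zero_iff.2 fun j _ => hP j
  have : ∃ t : ℝ, 0 < t ∧ ¬ (∏ j, P j).IsRoot t := by
    by_contra! hcon
    exact hprod (Polynomial.eq_zero_of_infinite_isRoot _ ((Set.Ioi_infinite (0:ℝ)).mono fun t ht => hcon t ht))
  obtain ⟨t, ht, hr⟩ := this
  refine ⟨fun i => t ^ (e i : ℕ), fun i => by positivity, fun j h0 => hr ?_⟩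
  rw [Polynomial.IsRoot.def, Polynomial.eval_prod]
  apply Finset.prod_eq_zero (Finset.mem_univ j)
  simp only [P, Polynomial.eval_finsetSum, Polynomial.eval_monomial]
  exact h0

set_option linter.unusedSectionVars false

section
variable {E ι : Type*} [NormedAddCommGroup E] [NormedSpace ℝ E] [FiniteDimensional ℝ E] [Fintype ι]

theorem aux_w (u : ι → E) : ∃ w : ι → ℝ, ∀ S : Finset ι, ¬ LinearIndepOn ℝ u (S : Set ι) →
    ∃ c : ι → ℝ, (∀ i, i ∉ S → c i = 0) ∧ ∑ i, c i • u i = 0 ∧ 0 < ∑ i, c i * w i := by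
  classical
  have key : ∀ S : {S : Finset ι // ¬ LinearIndepOn ℝ u (S : Set ι)},
      ∃ c : ι → ℝ, (∀ i, i ∉ S.1 → c i = 0) ∧ ∑ i, c i • u i = 0 ∧ c ≠ 0 := by
    rintro ⟨S, hS⟩
    rw [linearIndepOn_finset_iff] at hS
    push Not at hS
    obtain ⟨f, hf, i, hi, hfi⟩ := hS
    refine ⟨fun i => if i ∈ S then f i else 0, fun i hi => by simp_all, ?_, ?_⟩
    · simpa [ite_smul, Finset.sum_ite_mem] using hf
    · intro h0
      have := congrFun h0 i
      simp [hi, hfi] at this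
  choose c h1 h2 h3 using key
  obtain ⟨w, -, hw⟩ := aux_generic c h3
  refine ⟨w, fun S hS => ?_⟩
  rcases lt_or_gt_of_ne (hw ⟨S, hS⟩) with h | h
  · refine ⟨fun i => - c ⟨S, hS⟩ i, fun i hi => by simp [h1 ⟨S, hS⟩ i hi], ?_, ?_⟩
    · simp [h2]
    · simpa using h
  · exact ⟨c ⟨S, hS⟩, h1 ⟨S, hS⟩, h2 _, h⟩

/-- generic vectors -/
def Gen (u : ι → E) (y : E) : Prop :=
  ∀ S : Finset ι, S.card < Module.finrank ℝ E → ∃ f : E →ₗ[ℝ] ℝ, (∀ i ∈ S, f (u i) = 0) ∧ f y ≠ 0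

theorem aux_q (u : ι → E) (hu : Submodule.span ℝ (Set.range u) = ⊤) :
    ∃ μ : ι → ℝ, (∀ i, 0 < μ i) ∧ Gen u (∑ i, μ i • u i) := by
  classical
  have key : ∀ S : {S : Finset ι // S.card < Module.finrank ℝ E},
      ∃ f : E →ₗ[ℝ] ℝ, (∀ i ∈ S.1, f (u i) = 0) ∧ f ≠ 0 := by
    rintro ⟨S, hS⟩
    have hlt : Submodule.span ℝ ((S.image u : Finset E) : Set E) < ⊤ := by
      rw [lt_top_iff_ne_top]
      intro h
      have h1 := finrank_span_finset_le_card (R := ℝ) (S.image u)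
      rw [Set.finrank, h, finrank_top] at h1
      have := Finset.card_image_le (s := S) (f := u)
      omega
    obtain ⟨f, hf, hle⟩ := Submodule.exists_le_ker_of_lt_top _ hlt
    refine ⟨f, fun i hi => ?_, hf⟩
    exact hle (Submodule.subset_span (by simpa using ⟨i, hi, rfl⟩))
  choose f h1 h2 using key
  obtain ⟨μ, hμ, hw⟩ := aux_generic (fun S i => f S (u i)) (by
    intro S h0
    apply h2 S
    apply LinearMap.ext_on hu
    rintro _ ⟨i, rfl⟩
    exact congrFun h0 i)
  refine ⟨μ, hμ, fun S hS => ⟨f ⟨S, hS⟩, h1 ⟨S, hS⟩, ?_⟩⟩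
  rw [map_sum]
  have := hw ⟨S, hS⟩
  simpa [mul_comm] using this

/-- dual family -/
def IsDual [DecidableEq ι] (u : ι → E) (B : Finset ι) (β : ι → E →ₗ[ℝ] ℝ) : Prop :=
  (∀ i ∈ B, ∀ j ∈ B, β i (u j) = if i = j then 1 else 0) ∧ ∀ y, y = ∑ i ∈ B, β i y • u i

theorem aux_dual [DecidableEq ι] (u : ι → E) (B : Finset ι) (hB : LinearIndepOn ℝ u (B : Set ι))
    (hc : B.card = Module.finrank ℝ E) : ∃ β, IsDual u B β := by
  have hli : LinearIndependent ℝ (fun i : B => u i) := hB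
  have hs : Submodule.span ℝ (Set.range (fun i : B => u i)) = ⊤ :=
    hli.span_eq_top_of_card_eq_finrank' (by simpa using hc)
  let b := Module.Basis.mk hli hs.ge
  refine ⟨fun i => if h : i ∈ B then b.coord ⟨i, h⟩ else 0, ?_, ?_⟩
  · intro i hi j hj
    have : u j = b ⟨j, hj⟩ := by simp [b]
    rw [this]
    simp only [hi, dif_pos, Module.Basis.coord_apply, Module.Basis.repr_self, Finsupp.single_apply,
      Subtype.mk.injEq, eq_comm]
  · intro y
    conv_lhs => rw [← b.sum_repr y]
    rw [← Finset.sum_coe_sort B]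
    apply Finset.sum_congr rfl
    rintro ⟨i, hi⟩ _
    simp [hi, b]

theorem aux_opt [DecidableEq ι] (u : ι → E) (ht : E →ₗ[ℝ] ℝ) (hht : ∀ i, ht (u i) = 1) (w : ι → ℝ)
    (hw : ∀ S : Finset ι, ¬ LinearIndepOn ℝ u (S : Set ι) →
    ∃ c : ι → ℝ, (∀ i, i ∉ S → c i = 0) ∧ ∑ i, c i • u i = 0 ∧ 0 < ∑ i, c i * w i)
    (l₀ : ι → ℝ) (hl₀ : ∀ i, 0 ≤ l₀ i) (y : E) (hy : ∑ i, l₀ i • u i = y) (hg : Gen u y) :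
    ∃ B : Finset ι, LinearIndepOn ℝ u (B : Set ι) ∧ B.card = Module.finrank ℝ E ∧
     (∃ φ : E →ₗ[ℝ] ℝ, (∀ i ∈ B, φ (u i) = w i) ∧ ∀ i ∉ B, φ (u i) < w i) ∧
     ∃ l : ι → ℝ, (∀ i ∈ B, 0 < l i) ∧ (∀ i ∉ B, l i = 0) ∧ ∑ i, l i • u i = y := by
  let Λ : Set (ι → ℝ) := {l | (∀ i, 0 ≤ l i) ∧ ∑ i, l i • u i = y}
  have hclosed : IsClosed Λ := by
    have hΛ : Λ = (⋂ i : ι, {l : ι → ℝ | 0 ≤ l i}) ∩ {l | ∑ i, l i • u i = y} := by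
      ext l
      simp [Λ]
    rw [hΛ]
    apply IsClosed.inter
    · exact isClosed_iInter fun i => isClosed_le continuous_const (continuous_apply i)
    · exact isClosed_eq (by fun_prop) continuous_const
  have hsub : Λ ⊆ Set.Icc 0 (fun _ => ht y) := by
    rintro l ⟨h1, h2⟩
    refine ⟨h1, fun i => ?_⟩
    rw [← h2, map_sum]
    simp only [map_smul, hht, smul_eq_mul, mul_one]
    exact Finset.single_le_sum (f := l) (fun j _ => h1 j) (Finset.mem_univ i)
  have hcomp : IsCompact Λ := isCompact_Icc.of_isClosed_subset hclosed hsub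
  obtain ⟨l, ⟨hl1, hl2⟩, hmin⟩ := hcomp.exists_isMinOn ⟨l₀, hl₀, hy⟩
    (f := fun l : ι → ℝ => ∑ i, l i * w i) (by fun_prop)
  -- perturbation principle
  have pert : ∀ c : ι → ℝ, ∑ i, c i • u i = 0 → (∀ i, l i = 0 → 0 ≤ c i) →
      0 ≤ ∑ i, c i * w i := by
    intro c hc hpos
    have hev : ∀ᶠ ε : ℝ in nhdsWithin 0 (Set.Ioi 0), ∀ i, 0 ≤ l i + ε * c i := by
      rw [Filter.eventually_all]
      intro i
      rcases (hl1 i).eq_or_lt with h | h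
      · filter_upwards [self_mem_nhdsWithin] with ε hε
        rw [← h, zero_add]
        exact mul_nonneg (le_of_lt hε) (hpos i h.symm)
      · have : Filter.Tendsto (fun ε : ℝ => l i + ε * c i) (nhdsWithin 0 (Set.Ioi 0)) (nhds (l i + 0 * c i)) :=
          (Continuous.tendsto (by fun_prop) 0).mono_left nhdsWithin_le_nhds
        filter_upwards [this.eventually (lt_mem_nhds (by simpa using h : 0 < l i + 0 * c i))] with ε hε using hε.le
    obtain ⟨ε, h1, h2⟩ := (hev.and self_mem_nhdsWithin).exists
    have hmem : (fun i => l i + ε * c i) ∈ Λ := by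
      refine ⟨h1, ?_⟩
      simp only [add_smul, mul_smul, Finset.sum_add_distrib, ← Finset.smul_sum, hc, hl2, smul_zero, add_zero]
    have h3 : ∑ i, l i * w i ≤ ∑ i, (l i + ε * c i) * w i := hmin hmem
    simp only [add_mul, mul_assoc, Finset.sum_add_distrib, ← Finset.mul_sum] at h3
    have h2' : 0 < ε := h2
    by_contra hneg
    push Not at hneg
    nlinarith
  let B : Finset ι := Finset.univ.filter fun i => 0 < l i
  have hBpos : ∀ i ∈ B, 0 < l i := fun i hi => by simpa [B] using hi
  have hBz : ∀ i ∉ B, l i = 0 := fun i hi => le_antisymm (by simpa [B] using hi) (hl1 i)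
  have hli : LinearIndepOn ℝ u (B : Set ι) := by
    by_contra hd
    obtain ⟨c, hc1, hc2, hc3⟩ := hw B hd
    have := pert (fun i => - c i) (by simp [hc2]) (fun i hi => by
      have : i ∉ B := fun h => (hBpos i h).ne' hi
      simp [hc1 i this])
    simp at this
    linarith
  have hysum : y = ∑ i ∈ B, l i • u i := by
    rw [← hl2]
    symm
    apply Finset.sum_subset (Finset.subset_univ _)
    intro i _ hi
    simp [hBz i hi]
  have hcard : B.card = Module.finrank ℝ E := by
    apply le_antisymm
    · have := LinearIndependent.fintype_card_le_finrank (R := ℝ) (b := fun i : B => u i) hli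
      simpa using this
    · by_contra hlt
      push Not at hlt
      obtain ⟨f, hf1, hf2⟩ := hg B hlt
      apply hf2
      rw [hysum, map_sum]
      apply Finset.sum_eq_zero
      intro i hi
      simp [hf1 i hi]
  refine ⟨B, hli, hcard, ?_, l, hBpos, hBz, hl2⟩
  obtain ⟨β, hβ1, hβ2⟩ := aux_dual u B hli hcard
  let φ : E →ₗ[ℝ] ℝ := ∑ i ∈ B, w i • β i
  have hφ : ∀ i ∈ B, φ (u i) = w i := by
    intro i hi
    simp only [φ, LinearMap.sum_apply, LinearMap.smul_apply, smul_eq_mul]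
    rw [Finset.sum_congr rfl (fun j hj => by rw [hβ1 j hj i hi])]
    simp [hi]
  refine ⟨φ, hφ, ?_⟩
  intro k hk
  -- relation on insert k B
  have hdep : ¬ LinearIndepOn ℝ u ((insert k B : Finset ι) : Set ι) := by
    intro h
    have := LinearIndependent.fintype_card_le_finrank (R := ℝ) (b := fun i : (insert k B : Finset ι) => u i) h
    rw [Fintype.card_coe, Finset.card_insert_of_notMem hk] at this
    omega
  obtain ⟨c, hc1, hc2, hc3⟩ := hw _ hdep
  have hsum : ∀ g : ι → ℝ, ∑ i, c i * g i = c k * g k + ∑ i ∈ B, c i * g i := by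
    intro g
    rw [← Finset.sum_insert (f := fun i => c i * g i) hk]
    symm
    apply Finset.sum_subset (Finset.subset_univ _)
    intro i _ hi
    simp [hc1 i hi]
  have hφ0 : ∑ i, c i * φ (u i) = 0 := by
    have := congrArg φ hc2
    simpa [map_sum] using this
  have h1 := hsum w
  have h2 := hsum (fun i => φ (u i))
  have h2' : ∑ i ∈ B, c i * φ (u i) = ∑ i ∈ B, c i * w i :=
    Finset.sum_congr rfl (fun i hi => by rw [hφ i hi])
  have hne : 0 < c k * (w k - φ (u k)) := by linarith
  have hge : 0 < c k := by
    by_contra hcon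
    have hk0 : c k ≠ 0 := by rintro h; simp [h] at hne
    have hlt : c k < 0 := lt_of_le_of_ne (not_lt.1 hcon) hk0
    have := pert (fun i => - c i) (by simp [hc2]) (fun i hi => by
      have hiB : i ∉ B := fun h => (hBpos i h).ne' hi
      by_cases hik : i = k
      · subst hik; linarith
      · have : i ∉ insert k B := by simp [hik, hiB]
        simp [hc1 i this])
    simp at this
    linarith
  have := (pos_iff_pos_of_mul_pos hne).1 hge
  linarith


theorem aux_ev (a b : ℝ) (hb : b ≠ 0) : ∀ᶠ ε : ℝ in nhdsWithin 0 (Set.Ioi 0),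
    (0 < a + ε * b ↔ (0 < a ∨ (a = 0 ∧ 0 < b))) ∧ a + ε * b ≠ 0 := by
  have ht : Filter.Tendsto (fun ε : ℝ => a + ε * b) (nhdsWithin 0 (Set.Ioi 0)) (nhds a) := by
    have : Filter.Tendsto (fun ε : ℝ => a + ε * b) (nhdsWithin 0 (Set.Ioi 0)) (nhds (a + 0 * b)) :=
      (Continuous.tendsto (by fun_prop) 0).mono_left nhdsWithin_le_nhds
    simpa using this
  rcases lt_trichotomy a 0 with h | h | h
  · filter_upwards [ht.eventually (gt_mem_nhds h)] with ε hε
    exact ⟨⟨fun h' => absurd h' (not_lt.2 hε.le), by rintro (h' | h') <;> linarith⟩, hε.ne⟩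
  · filter_upwards [self_mem_nhdsWithin] with ε hε
    have hε' : 0 < ε := hε
    subst h
    simp [hε', hε'.ne', hb]
  · filter_upwards [ht.eventually (lt_mem_nhds h)] with ε hε
    exact ⟨by simp [hε, h], hε.ne'⟩

/-- membership in the cone -/
def InCone (u : ι → E) (x : E) : Prop := ∃ l : ι → ℝ, (∀ i, 0 ≤ l i) ∧ ∑ i, l i • u i = x

/-- half-open simplicial cone -/
def HO (B : Finset ι) (β : ι → E →ₗ[ℝ] ℝ) (s : ι → Prop) (x : E) : Prop :=
  ∀ i ∈ B, 0 < β i x ∨ (β i x = 0 ∧ s i)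

theorem aux_le [DecidableEq ι] (u : ι → E) (w : ι → ℝ) (B B' : Finset ι) (φ φ' : E →ₗ[ℝ] ℝ)
    (h1 : ∀ i ∈ B, φ (u i) = w i) (h2 : ∀ i ∉ B, φ (u i) < w i)
    (h1' : ∀ i ∈ B', φ' (u i) = w i) (β' : ι → E →ₗ[ℝ] ℝ) (hβ : IsDual u B' β')
    (y : E) (hy : ∀ i ∈ B', 0 < β' i y) : φ y ≤ φ' y ∧ (φ y = φ' y → B' ⊆ B) := by
  have e1 : φ y = ∑ i ∈ B', β' i y * φ (u i) := by
    conv_lhs => rw [hβ.2 y]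
    simp [map_sum]
  have e2 : φ' y = ∑ i ∈ B', β' i y * w i := by
    conv_lhs => rw [hβ.2 y]
    rw [map_sum]
    exact Finset.sum_congr rfl fun i hi => by simp [h1' i hi]
  have hle : ∀ i ∈ B', β' i y * φ (u i) ≤ β' i y * w i := by
    intro i hi
    apply mul_le_mul_of_nonneg_left _ (hy i hi).le
    by_cases h : i ∈ B
    · exact (h1 i h).le
    · exact (h2 i h).le
  rw [e1, e2]
  refine ⟨Finset.sum_le_sum hle, fun heq i hi => ?_⟩
  by_contra hn
  have := (Finset.sum_eq_sum_iff_of_le hle).1 heq i hi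
  have h3 := mul_lt_mul_of_pos_left (h2 i hn) (hy i hi)
  linarith

theorem aux_tri [DecidableEq ι] (u : ι → E) (hu : Submodule.span ℝ (Set.range u) = ⊤)
    (ht : E →ₗ[ℝ] ℝ) (hht : ∀ i, ht (u i) = 1) :
    ∃ (T : Finset (Finset ι)) (β : Finset ι → ι → E →ₗ[ℝ] ℝ) (s : Finset ι → ι → Prop),
      (∀ B ∈ T, B.card = Module.finrank ℝ E ∧ IsDual u B (β B)) ∧
      (∀ x, InCone u x ↔ ∃ B ∈ T, HO B (β B) (s B) x) ∧
      (∀ x, ∀ B ∈ T, ∀ B' ∈ T, HO B (β B) (s B) x → HO B' (β B') (s B') x → B = B') := by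
  classical
  obtain ⟨w, hw⟩ := aux_w u
  obtain ⟨μ, hμ, hq⟩ := aux_q u hu
  set q := ∑ i, μ i • u i with hqdef
  let T : Finset (Finset ι) := Finset.univ.filter fun B =>
    LinearIndepOn ℝ u (B : Set ι) ∧ B.card = Module.finrank ℝ E ∧
     (∃ φ : E →ₗ[ℝ] ℝ, (∀ i ∈ B, φ (u i) = w i) ∧ ∀ i ∉ B, φ (u i) < w i)
  have hT : ∀ B, B ∈ T ↔ LinearIndepOn ℝ u (B : Set ι) ∧ B.card = Module.finrank ℝ E ∧
     (∃ φ : E →ₗ[ℝ] ℝ, (∀ i ∈ B, φ (u i) = w i) ∧ ∀ i ∉ B, φ (u i) < w i) := by simp [T]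
  have hex : ∀ B : Finset ι, ∃ β, B ∈ T → IsDual u B β := by
    intro B
    by_cases hB : B ∈ T
    · obtain ⟨β, hβ⟩ := aux_dual u B ((hT B).1 hB).1 ((hT B).1 hB).2.1
      exact ⟨β, fun _ => hβ⟩
    · exact ⟨0, fun h => absurd h hB⟩
  choose β hβ using hex
  have hβq : ∀ B ∈ T, ∀ i ∈ B, β B i q ≠ 0 := by
    intro B hB i hi h0
    have hc : (B.erase i).card < Module.finrank ℝ E := by
      rw [← ((hT B).1 hB).2.1]
      exact Finset.card_erase_lt_of_mem hi
    obtain ⟨f, hf1, hf2⟩ := hq _ hc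
    apply hf2
    rw [(hβ B hB).2 q, map_sum]
    apply Finset.sum_eq_zero
    intro j hj
    by_cases hji : j = i
    · subst hji; simp [h0]
    · simp [hf1 j (Finset.mem_erase.2 ⟨hji, hj⟩)]
  let s : Finset ι → ι → Prop := fun B i => 0 < β B i q
  -- transfer
  have hev1 : ∀ x, ∀ᶠ ε : ℝ in nhdsWithin 0 (Set.Ioi 0), ∀ B ∈ T,
      (HO B (β B) (s B) x ↔ ∀ i ∈ B, 0 < β B i (x + ε • q)) := by
    intro x
    have : ∀ᶠ ε : ℝ in nhdsWithin 0 (Set.Ioi 0), ∀ B : T, ∀ i : B.1,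
      (0 < β B i x + ε * β B i q ↔ (0 < β B i x ∨ (β B i x = 0 ∧ 0 < β B i q))) ∧
        β B i x + ε * β B i q ≠ 0 := by
      rw [Filter.eventually_all]
      intro B
      rw [Filter.eventually_all]
      intro i
      exact aux_ev _ _ (hβq B.1 B.2 i.1 i.2)
    filter_upwards [this] with ε hε B hB
    apply forall₂_congr
    intro i hi
    rw [map_add, map_smul, smul_eq_mul]
    exact (hε ⟨B, hB⟩ ⟨i, hi⟩).1.symm
  have hev2 : ∀ x, ∀ᶠ ε : ℝ in nhdsWithin 0 (Set.Ioi 0), Gen u (x + ε • q) := by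
    intro x
    unfold Gen
    rw [Filter.eventually_all]
    intro S
    by_cases hS : S.card < Module.finrank ℝ E
    · obtain ⟨f, hf1, hf2⟩ := hq S hS
      filter_upwards [aux_ev (f x) (f q) hf2] with ε hε _
      refine ⟨f, hf1, ?_⟩
      simpa using hε.2
    · exact Filter.Eventually.of_forall fun ε h => absurd h hS
  refine ⟨T, β, s, fun B hB => ⟨((hT B).1 hB).2.1, hβ B hB⟩, fun x => ⟨?_, ?_⟩, ?_⟩
  · rintro ⟨l, hl1, hl2⟩
    obtain ⟨ε, ⟨h1, h2⟩, h3⟩ := (((hev1 x).and (hev2 x)).and self_mem_nhdsWithin).exists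
    have h3' : 0 < ε := h3
    obtain ⟨B, hB1, hB2, hB3, l', hl1', hl2', hl3'⟩ := aux_opt u ht hht w hw (fun i => l i + ε * μ i)
      (fun i => add_nonneg (hl1 i) (mul_nonneg h3'.le (hμ i).le)) (x + ε • q) (by
        simp only [add_smul, mul_smul, Finset.sum_add_distrib, ← Finset.smul_sum, hl2, hqdef]) h2
    have hB : B ∈ T := (hT B).2 ⟨hB1, hB2, hB3⟩
    refine ⟨B, hB, (h1 B hB).2 ?_⟩
    intro i hi
    have : β B i (x + ε • q) = l' i := by
      rw [← hl3', map_sum, Finset.sum_eq_single i]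
      · rw [map_smul, (hβ B hB).1 i hi i hi]; simp
      · intro j _ hji
        by_cases hj : j ∈ B
        · rw [map_smul, (hβ B hB).1 i hi j hj, if_neg (Ne.symm hji)]; simp
        · simp [hl2' j hj]
      · simp
    rw [this]
    exact hl1' i hi
  · rintro ⟨B, hB, hx⟩
    refine ⟨fun i => if i ∈ B then β B i x else 0, fun i => ?_, ?_⟩
    · by_cases hi : i ∈ B
      · rcases hx i hi with h | h
        · simp [hi, h.le]
        · simp [hi, h.1]
      · simp [hi]
    · simp only [ite_smul, zero_smul, Finset.sum_ite_mem, Finset.univ_inter]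
      exact ((hβ B hB).2 x).symm
  · intro x B hB B' hB' hx hx'
    obtain ⟨ε, h1⟩ := (hev1 x).exists
    have p := (h1 B hB).1 hx
    have p' := (h1 B' hB').1 hx'
    obtain ⟨φ, f1, f2⟩ := ((hT B).1 hB).2.2
    obtain ⟨φ', f1', f2'⟩ := ((hT B').1 hB').2.2
    have a1 := aux_le u w B B' φ φ' f1 f2 f1' _ (hβ B' hB') _ p'
    have a2 := aux_le u w B' B φ' φ f1' f2' f1 _ (hβ B hB) _ p
    have e := le_antisymm a1.1 a2.1
    exact Finset.Subset.antisymm (a2.2 e.symm) (a1.2 e)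

end

section
variable {L ι : Type*} [AddCommGroup L]

/-- generating function -/
noncomputable def GF (ht : L →+ ℤ) (A : Set L) : PowerSeries ℤ :=
  PowerSeries.mk fun ℓ => (Set.ncard {x | x ∈ A ∧ ht x = (ℓ : ℤ)} : ℤ)

theorem aux_step (ht : L →+ ℤ) (b : L) (hb : ht b = 1) (A : Set L)
    (hfin : ∀ ℓ : ℕ, {x | x ∈ A ∧ ht x = (ℓ : ℤ)}.Finite) (hpos : ∀ x ∈ A, 0 ≤ ht x)
    (hadd : ∀ x ∈ A, x + b ∈ A) :
    GF ht A * (1 - PowerSeries.X) = GF ht {x | x ∈ A ∧ x - b ∉ A} := by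
  ext ℓ
  rw [mul_sub, mul_one, map_sub]
  cases ℓ with
  | zero =>
    simp only [GF, PowerSeries.coeff_mk, PowerSeries.coeff_zero_mul_X, sub_zero]
    congr 2
    ext x
    simp only [Set.mem_ofPred_eq]
    constructor
    · rintro ⟨h1, h2⟩
      refine ⟨⟨h1, fun h => ?_⟩, h2⟩
      have := hpos _ h
      rw [map_sub, hb, h2] at this
      simp at this
    · rintro ⟨⟨h1, -⟩, h2⟩
      exact ⟨h1, h2⟩
  | succ ℓ =>
    simp only [GF, PowerSeries.coeff_mk, PowerSeries.coeff_succ_mul_X]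
    have hinj : Function.Injective (fun x : L => x + b) := add_left_injective b
    rw [← Set.ncard_image_of_injective {x | x ∈ A ∧ ht x = (ℓ : ℤ)} hinj]
    have hsub : (fun x : L => x + b) '' {x | x ∈ A ∧ ht x = (ℓ : ℤ)} ⊆
        {x | x ∈ A ∧ ht x = ((ℓ + 1 : ℕ) : ℤ)} := by
      rintro _ ⟨x, ⟨h1, h2⟩, rfl⟩
      exact ⟨hadd x h1, by simp [hb, h2]⟩
    have h1 := Set.ncard_sdiff_add_ncard_of_subset hsub (hfin (ℓ + 1))
    have h2 : {x | x ∈ {x | x ∈ A ∧ x - b ∉ A} ∧ ht x = ((ℓ + 1 : ℕ) : ℤ)} =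
        {x | x ∈ A ∧ ht x = ((ℓ + 1 : ℕ) : ℤ)} \ ((fun x : L => x + b) '' {x | x ∈ A ∧ ht x = (ℓ : ℤ)}) := by
      ext x
      constructor
      · rintro ⟨⟨p1, p2⟩, p3⟩
        refine ⟨⟨p1, p3⟩, ?_⟩
        rintro ⟨z, ⟨z1, z2⟩, rfl⟩
        apply p2
        simpa using z1
      · rintro ⟨⟨p1, p3⟩, p4⟩
        refine ⟨⟨p1, fun h => p4 ⟨x - b, ⟨h, ?_⟩, by simp⟩⟩, p3⟩
        rw [map_sub, p3, hb]
        push_cast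
        ring
    rw [h2]
    omega

theorem aux_count [DecidableEq ι] (ht : L →+ ℤ) (v : ι → L) (hv : ∀ i, ht (v i) = 1) (A : Set L)
    (hfin : ∀ ℓ : ℕ, {x | x ∈ A ∧ ht x = (ℓ : ℤ)}.Finite) (hpos : ∀ x ∈ A, 0 ≤ ht x)
    (T : Finset ι) (hadd : ∀ i ∈ T, ∀ x ∈ A, x + v i ∈ A)
    (hcomm : ∀ i ∈ T, ∀ j ∈ T, i ≠ j → ∀ x ∈ A, x + v i - v j ∈ A → x - v j ∈ A) :
    GF ht A * (1 - PowerSeries.X) ^ T.card = GF ht {x | x ∈ A ∧ ∀ i ∈ T, x - v i ∉ A} := by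
  induction T using Finset.induction_on with
  | empty => simp
  | insert i T hi ih =>
    rw [Finset.card_insert_of_notMem hi, pow_succ, ← mul_assoc,
      ih (fun j hj => hadd j (Finset.mem_insert_of_mem hj))
        (fun j hj k hk => hcomm j (Finset.mem_insert_of_mem hj) k (Finset.mem_insert_of_mem hk)),
      aux_step ht (v i) (hv i)]
    · congr 1
      ext x
      constructor
      · rintro ⟨⟨h1, h2⟩, h3⟩
        refine ⟨h1, fun j hj => ?_⟩
        rcases Finset.mem_insert.1 hj with rfl | hj
        · intro h
          apply h3
          refine ⟨h, fun k hk hk' => h2 k hk ?_⟩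
          have := hadd j (Finset.mem_insert_self _ _) _ hk'
          convert this using 1
          abel
        · exact h2 j hj
      · rintro ⟨h1, h2⟩
        exact ⟨⟨h1, fun j hj => h2 j (Finset.mem_insert_of_mem hj)⟩,
          fun h => h2 i (Finset.mem_insert_self _ _) h.1⟩
    · intro ℓ
      exact (hfin ℓ).subset fun x hx => ⟨hx.1.1, hx.2⟩
    · exact fun x hx => hpos x hx.1
    · rintro x ⟨h1, h2⟩
      refine ⟨hadd i (Finset.mem_insert_self _ _) x h1, fun j hj h => h2 j hj ?_⟩
      exact hcomm i (Finset.mem_insert_self _ _) j (Finset.mem_insert_of_mem hj)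
        (fun h => hi (h ▸ hj)) x h1 h

theorem aux_nonneg [DecidableEq ι] (ht : L →+ ℤ) (v : ι → L) (hv : ∀ i, ht (v i) = 1) (A : Set L)
    (hfin : ∀ ℓ : ℕ, {x | x ∈ A ∧ ht x = (ℓ : ℤ)}.Finite) (hpos : ∀ x ∈ A, 0 ≤ ht x)
    (T : Finset ι) (hadd : ∀ i ∈ T, ∀ x ∈ A, x + v i ∈ A)
    (hcomm : ∀ i ∈ T, ∀ j ∈ T, i ≠ j → ∀ x ∈ A, x + v i - v j ∈ A → x - v j ∈ A) (ℓ : ℕ) :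
    0 ≤ PowerSeries.coeff ℓ (GF ht A * (1 - PowerSeries.X) ^ T.card) := by
  rw [aux_count ht v hv A hfin hpos T hadd hcomm]
  simp [GF]

end

/-- general version -/
theorem aux_main {E ι L : Type*} [NormedAddCommGroup E] [NormedSpace ℝ E] [FiniteDimensional ℝ E]
    [Fintype ι] [AddCommGroup L] (e : L →+ E) (v : ι → L)
    (hu : Submodule.span ℝ (Set.range fun i => e (v i)) = ⊤)
    (htE : E →ₗ[ℝ] ℝ) (ht : L →+ ℤ) (hh : ∀ x, htE (e x) = ht x) (hv : ∀ i, ht (v i) = 1)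
    (hfin : ∀ ℓ : ℕ, {x | InCone (fun i => e (v i)) (e x) ∧ ht x = (ℓ : ℤ)}.Finite) (ℓ : ℕ) :
    0 ≤ PowerSeries.coeff ℓ (GF ht {x | InCone (fun i => e (v i)) (e x)} *
      (1 - PowerSeries.X) ^ (Module.finrank ℝ E)) := by
  classical
  obtain ⟨T, β, s, h1, h2, h3⟩ := aux_tri (fun i => e (v i)) hu htE (fun i => by simp [hh, hv])
  let A : Finset ι → Set L := fun B => {x | HO B (β B) (s B) (e x)}
  have hfinB : ∀ B ∈ T, ∀ ℓ : ℕ, {x | x ∈ A B ∧ ht x = (ℓ : ℤ)}.Finite := fun B hB ℓ =>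
    (hfin ℓ).subset fun x hx => ⟨(h2 _).2 ⟨B, hB, hx.1⟩, hx.2⟩
  have hsum : GF ht {x | InCone (fun i => e (v i)) (e x)} = ∑ B ∈ T, GF ht (A B) := by
    ext m
    rw [map_sum]
    simp only [GF, PowerSeries.coeff_mk]
    rw [← Nat.cast_sum]
    congr 1
    have hU : {x | x ∈ {x | InCone (fun i => e (v i)) (e x)} ∧ ht x = (m : ℤ)} =
        ((T.attach.biUnion fun B => (hfinB B.1 B.2 m).toFinset : Finset L) : Set L) := by
      ext x
      simp only [Set.mem_ofPred_eq, Finset.coe_biUnion, Set.mem_iUnion, Set.Finite.coe_toFinset,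
        Finset.mem_coe, Finset.mem_attach, h2]
      constructor
      · rintro ⟨⟨B, hB, hx⟩, hm⟩
        exact ⟨⟨B, hB⟩, trivial, hx, hm⟩
      · rintro ⟨⟨B, hB⟩, -, hx, hm⟩
        exact ⟨⟨B, hB, hx⟩, hm⟩
    rw [hU, Set.ncard_coe_finset, Finset.card_biUnion, ← Finset.sum_attach T]
    · apply Finset.sum_congr rfl
      intro B _
      rw [Set.ncard_eq_toFinset_card _ (hfinB B.1 B.2 m)]
    · intro B _ B' _ hne
      rw [Function.onFun, Finset.disjoint_left]
      intro x hx hx'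
      rw [Set.Finite.mem_toFinset] at hx hx'
      exact hne (Subtype.ext (h3 _ _ B.2 _ B'.2 hx.1 hx'.1))
  rw [hsum, Finset.sum_mul, map_sum]
  apply Finset.sum_nonneg
  intro B hB
  rw [← (h1 B hB).1]
  have hd := (h1 B hB).2
  apply aux_nonneg ht v hv (A B) (hfinB B hB)
  · intro x hx
    have : InCone (fun i => e (v i)) (e x) := (h2 _).2 ⟨B, hB, hx⟩
    obtain ⟨l, hl1, hl2⟩ := this
    have h4 : (ht x : ℝ) = ∑ i, l i := by
      rw [← hh, ← hl2, map_sum]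
      simp [hh, hv]
    have : (0 : ℝ) ≤ ht x := by
      rw [h4]
      exact Finset.sum_nonneg fun i _ => hl1 i
    exact_mod_cast this
  · intro i hi x hx j hj
    rw [map_add, map_add, hd.1 j hj i hi]
    split_ifs
    · left
      rcases hx j hj with h | h <;> linarith
    · simpa using hx j hj
  · intro i hi j hj hij x hx hx' k hk
    have hk1 := hx k hk
    have hk2 := hx' k hk
    rw [map_sub, map_add, map_sub, map_add, hd.1 k hk i hi, hd.1 k hk j hj] at hk2
    rw [map_sub, map_sub, hd.1 k hk j hj]
    by_cases hkj : k = j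
    · subst hkj
      rw [if_neg hij.symm, add_zero] at hk2
      exact hk2
    · simpa [hkj] using hk1

/-- lattice embedding -/
noncomputable def latEmb (n : ℕ) : ((Fin n → ℤ) × ℤ) →+ ((Fin n → ℝ) × ℝ) where
  toFun p := (fun i => (p.1 i : ℝ), (p.2 : ℝ))
  map_zero' := by ext <;> simp
  map_add' p q := by ext <;> simp

theorem aux_cone_iff (n : ℕ) (V : Finset (Fin n → ℤ)) (Q : Set (Fin n → ℝ))
    (hQ : Q = convexHull ℝ ((fun v : Fin n → ℤ => fun i => (v i : ℝ)) '' V))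
    (x : Fin n → ℝ) (t : ℝ) (ht : 0 < t) :
    InCone (fun v : V => latEmb n (v.1, 1)) (x, t) ↔ x ∈ t • Q := by
  constructor
  · rintro ⟨l, h1, h2⟩
    have hs : ∑ i, l i = t := by
      have := congrArg Prod.snd h2
      simpa [latEmb, Prod.snd_sum] using this
    have hx : ∑ i, l i • (fun j => ((i.1 j : ℤ) : ℝ)) = x := by
      have := congrArg Prod.fst h2
      simpa [latEmb, Prod.fst_sum] using this
    rw [Set.mem_smul_set_iff_inv_smul_mem₀ ht.ne', hQ, ← hx, Finset.smul_sum]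
    simp only [smul_smul]
    apply (convex_convexHull ℝ _).sum_mem
    · exact fun i _ => mul_nonneg (by positivity) (h1 i)
    · rw [← Finset.mul_sum, hs, inv_mul_cancel₀ ht.ne']
    · intro i _
      exact subset_convexHull ℝ _ ⟨i.1, i.2, rfl⟩
  · rintro ⟨z, hz, rfl⟩
    have key : Q ⊆ {z | InCone (fun v : V => latEmb n (v.1, 1)) (z, 1)} := by
      rw [hQ]
      apply convexHull_min
      · rintro _ ⟨v, hv, rfl⟩
        classical
        refine ⟨fun i => if i = ⟨v, hv⟩ then 1 else 0, fun i => by dsimp only; split_ifs <;> simp, ?_⟩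
        simp [latEmb]
      · rintro a ⟨l, hl1, hl2⟩ b ⟨m, hm1, hm2⟩ c d hc hd hcd
        refine ⟨fun i => c * l i + d * m i, fun i => by have := hl1 i; have := hm1 i; positivity, ?_⟩
        simp only [add_smul, mul_smul, Finset.sum_add_distrib, ← Finset.smul_sum, hl2, hm2]
        simp [hcd]
    obtain ⟨l, hl1, hl2⟩ := key hz
    refine ⟨fun i => t * l i, fun i => mul_nonneg ht.le (hl1 i), ?_⟩
    simp only [mul_smul, ← Finset.smul_sum, hl2]
    simp

theorem aux_span (n : ℕ) (V : Finset (Fin n → ℤ)) (Q : Set (Fin n → ℝ))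
    (hQ : Q = convexHull ℝ ((fun v : Fin n → ℤ => fun i => (v i : ℝ)) '' V))
    (hfull : (interior Q).Nonempty) :
    Submodule.span ℝ (Set.range fun v : V => latEmb n (v.1, 1)) = ⊤ := by
  by_contra hne
  obtain ⟨f, hf, hle⟩ := Submodule.exists_le_ker_of_lt_top _ (lt_top_iff_ne_top.2 hne)
  have hQ0 : ∀ x ∈ Q, f (x, 1) = 0 := by
    intro x hx
    obtain ⟨l, -, hl⟩ := (aux_cone_iff n V Q hQ x 1 one_pos).2 (by simpa using hx)
    rw [← hl, map_sum]
    apply Finset.sum_eq_zero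
    intro i _
    rw [map_smul]
    have : f (latEmb n (i.1, 1)) = 0 := hle (Submodule.subset_span ⟨i, rfl⟩)
    simp [this]
  obtain ⟨x, hx⟩ := hfull
  have hx0 := hQ0 x (interior_subset hx)
  have hg : ∀ d : Fin n → ℝ, f (d, 0) = 0 := by
    intro d
    have ht : Filter.Tendsto (fun ε : ℝ => x + ε • d) (nhdsWithin 0 (Set.Ioi 0)) (nhds x) := by
      have : Filter.Tendsto (fun ε : ℝ => x + ε • d) (nhdsWithin 0 (Set.Ioi 0)) (nhds (x + (0:ℝ) • d)) :=
        (Continuous.tendsto (by fun_prop) 0).mono_left nhdsWithin_le_nhds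
      simpa using this
    obtain ⟨ε, h1, h2⟩ := ((ht.eventually (mem_interior_iff_mem_nhds.1 hx)).and self_mem_nhdsWithin).exists
    have h3 := hQ0 _ h1
    have : ((x + ε • d, 1) : (Fin n → ℝ) × ℝ) = (x, 1) + ε • (d, 0) := by ext <;> simp
    rw [this, map_add, hx0, map_smul, zero_add, smul_eq_mul] at h3
    exact (mul_eq_zero.1 h3).resolve_left (ne_of_gt h2)
  apply hf
  apply LinearMap.ext
  rintro ⟨a, t⟩
  have : ((a, t) : (Fin n → ℝ) × ℝ) = t • (x, 1) + (a - t • x, 0) := by ext <;> simp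
  rw [this, map_add, map_smul, hx0, hg]
  simp

theorem aux_fin (n : ℕ) (V : Finset (Fin n → ℤ)) (ℓ : ℕ) :
    {x : (Fin n → ℤ) × ℤ | InCone (fun v : V => latEmb n (v.1, 1)) (latEmb n x) ∧
      AddMonoidHom.snd (Fin n → ℤ) ℤ x = (ℓ : ℤ)}.Finite := by
  let M : ℤ := ∑ v : V, ∑ i, |v.1 i|
  have hM : ∀ (v : V) i, |v.1 i| ≤ M := by
    intro v i
    calc |v.1 i| ≤ ∑ i, |v.1 i| :=
          Finset.single_le_sum (f := fun i => |v.1 i|) (fun j _ => abs_nonneg _) (Finset.mem_univ i)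
      _ ≤ M := Finset.single_le_sum (f := fun v : V => ∑ i, |v.1 i|)
          (fun j _ => Finset.sum_nonneg fun k _ => abs_nonneg _) (Finset.mem_univ v)
  apply ((Set.finite_Icc (fun _ : Fin n => -(ℓ * M)) (fun _ => ℓ * M)).prod
    (Set.finite_singleton (ℓ : ℤ))).subset
  rintro ⟨x, t⟩ ⟨⟨l, h1, h2⟩, ht⟩
  have ht' : t = ℓ := ht
  subst ht'
  have hs : ∑ i, l i = (ℓ : ℝ) := by
    have := congrArg Prod.snd h2
    simpa [latEmb, Prod.snd_sum] using this
  have hx : ∀ j, ∑ i, l i * (((i : V).1 j : ℤ) : ℝ) = (x j : ℝ) := by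
    intro j
    have := congrFun (congrArg Prod.fst h2) j
    simpa [latEmb, Prod.fst_sum] using this
  have hb : ∀ j, |x j| ≤ ℓ * M := by
    intro j
    have : |(x j : ℝ)| ≤ ℓ * (M : ℝ) := by
      rw [← hx j, ← hs, Finset.sum_mul]
      refine (Finset.abs_sum_le_sum_abs _ _).trans (Finset.sum_le_sum fun i _ => ?_)
      rw [abs_mul, abs_of_nonneg (h1 i)]
      apply mul_le_mul_of_nonneg_left _ (h1 i)
      exact_mod_cast hM i j
    exact_mod_cast this
  exact ⟨⟨fun j => (abs_le.1 (hb j)).1, fun j => (abs_le.1 (hb j)).2⟩, rfl⟩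

/-- Stanley nonnegativity: all entries of the Ehrhart h*-vector of a
full-dimensional lattice polytope are nonnegative. -/
theorem ehrhart_h_nonneg (n : ℕ) (V : Finset (Fin n → ℤ)) (Q : Set (Fin n → ℝ))
    (hQ : Q = convexHull ℝ ((fun v : Fin n → ℤ => fun i => (v i : ℝ)) '' V))
    (hfull : (interior Q).Nonempty)
    (h : ℕ → ℤ) (hsupp : ∀ ℓ, n < ℓ → h ℓ = 0)
    (hser : (PowerSeries.mk fun ℓ => if ℓ = 0 then (1 : ℤ) else
        (Nat.card {x : Fin n → ℤ // (fun i => (x i : ℝ)) ∈ (ℓ : ℝ) • Q} : ℤ)) *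
        (1 - PowerSeries.X) ^ (n + 1) = PowerSeries.mk h) :
    ∀ ℓ, 0 ≤ h ℓ := by
  intro ℓ
  have hGF : (PowerSeries.mk fun ℓ => if ℓ = 0 then (1 : ℤ) else
        (Nat.card {x : Fin n → ℤ // (fun i => (x i : ℝ)) ∈ (ℓ : ℝ) • Q} : ℤ)) =
      GF (AddMonoidHom.snd (Fin n → ℤ) ℤ)
        {x | InCone (fun v : V => latEmb n (v.1, 1)) (latEmb n x)} := by
    ext m
    simp only [GF, PowerSeries.coeff_mk]
    split_ifs with hm
    · subst hm
      have : {x : (Fin n → ℤ) × ℤ | x ∈ {x | InCone (fun v : V => latEmb n (v.1, 1)) (latEmb n x)} ∧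
          AddMonoidHom.snd (Fin n → ℤ) ℤ x = ((0 : ℕ) : ℤ)} = {0} := by
        ext ⟨x, t⟩
        constructor
        · rintro ⟨⟨l, h1, h2⟩, ht⟩
          have ht' : t = 0 := by simpa using ht
          subst ht'
          have hs : ∑ i, l i = (0 : ℝ) := by
            have := congrArg Prod.snd h2
            simpa [latEmb, Prod.snd_sum] using this
          have hl : ∀ i, l i = 0 := fun i =>
            (Finset.sum_eq_zero_iff_of_nonneg (fun i _ => h1 i)).1 hs i (Finset.mem_univ i)
          have hx : ∀ j, (x j : ℝ) = 0 := by
            intro j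
            have := congrFun (congrArg Prod.fst h2) j
            simpa [latEmb, Prod.fst_sum, hl, eq_comm] using this
          have : x = 0 := by
            funext j
            exact_mod_cast hx j
          simp [this]
        · intro hx
          rw [Set.mem_singleton_iff] at hx
          rw [hx]
          exact ⟨⟨0, fun i => le_rfl, by simp⟩, by simp⟩
      rw [this]
      simp
    · have hinj : Function.Injective (fun x : Fin n → ℤ => (x, (m : ℤ))) := fun a b hab =>
        congrArg Prod.fst hab
      have hm' : (0 : ℝ) < m := by exact_mod_cast Nat.pos_of_ne_zero hm
      have : {x : (Fin n → ℤ) × ℤ | x ∈ {x | InCone (fun v : V => latEmb n (v.1, 1)) (latEmb n x)} ∧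
          AddMonoidHom.snd (Fin n → ℤ) ℤ x = (m : ℤ)} =
          (fun x : Fin n → ℤ => (x, (m : ℤ))) '' {x | (fun i => (x i : ℝ)) ∈ (m : ℝ) • Q} := by
        ext ⟨x, t⟩
        have hiff := aux_cone_iff n V Q hQ (fun i => (x i : ℝ)) m hm'
        constructor
        · rintro ⟨hc, ht⟩
          have ht' : t = m := ht
          subst ht'
          exact ⟨x, hiff.1 (by simpa [latEmb] using hc), rfl⟩
        · rintro ⟨z, hz, hzz⟩
          obtain ⟨rfl, rfl⟩ := Prod.mk.inj hzz
          refine ⟨?_, rfl⟩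
          have := hiff.2 hz
          simpa [latEmb] using this
      rw [this, Set.ncard_image_of_injective _ hinj]
      rfl
  have key := aux_main (latEmb n) (fun v : V => (v.1, 1)) (aux_span n V Q hQ hfull)
    (LinearMap.snd ℝ (Fin n → ℝ) ℝ) (AddMonoidHom.snd (Fin n → ℤ) ℤ) (fun x => rfl) (fun i => rfl)
    (aux_fin n V) ℓ
  have hfr : Module.finrank ℝ ((Fin n → ℝ) × ℝ) = n + 1 := by simp
  rw [hfr, ← hGF, hser] at key
  simpa using key
end

section
/- Let T be a triangulation of an n-dimensional polytope Q ⊂ ℝ^n using vertices among a finite point set A = {a_0, …, a_N} ⊂ Q, and let ω ∈ ℝ^{N+1} be any height function. Let g_{ω,T} : Q → ℝ be the piecewise-linear function affine on each maximal simplex of T with g_{ω,T}(a_j) = ω_j for vertices a_j of T. Then ⟨ω, φ_A(T)⟩ = (n+1)! ∫_Q g_{ω,T}(x) dv, where φ_A(T) ∈ ℝ^{N+1} is the GKZ-vector of T. -/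
open MeasureTheory

/-- A triangulation of the polytope Q = Conv(range a) using vertices among the points
a_0, …, a_N: a finite collection of n-simplices with vertices in A, covering Q, with
pairwise disjoint interiors. -/
structure Triangulation (n N : ℕ) (a : Fin (N + 1) → (Fin n → ℝ)) where
  simplices : Finset (Finset (Fin (N + 1)))
  card_eq : ∀ C ∈ simplices, C.card = n + 1
  indep : ∀ C ∈ simplices, AffineIndependent ℝ (fun j : C => a (j : Fin (N + 1)))
  covers : (⋃ C ∈ simplices, convexHull ℝ (a '' (C : Set (Fin (N + 1))))) =
    convexHull ℝ (Set.range a)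
  inter : ∀ C ∈ simplices, ∀ C' ∈ simplices, C ≠ C' →
    interior (convexHull ℝ (a '' (C : Set (Fin (N + 1))))) ∩
      interior (convexHull ℝ (a '' (C' : Set (Fin (N + 1))))) = ∅

/-- The GKZ-vector of a triangulation: φ_A(T)_j = Σ_{C : a_j ∈ V(C)} n!·Vol(C). -/
noncomputable def gkzVector {n N : ℕ} (a : Fin (N + 1) → (Fin n → ℝ)) (T : Triangulation n N a)
    (j : Fin (N + 1)) : ℝ :=
  ∑ C ∈ T.simplices.filter (fun C => j ∈ C),
    (Nat.factorial n : ℝ) * (volume (convexHull ℝ (a '' (C : Set (Fin (N + 1)))))).toReal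


/-- Volume preservation for an affine involution. -/
theorem gkz_affine_invol_mp {n : ℕ} (σ : (Fin n → ℝ) →ᵃ[ℝ] (Fin n → ℝ))
    (hσ : ∀ x, σ (σ x) = x) : MeasurePreserving σ volume volume := by
  have hLL : σ.linear.comp σ.linear = LinearMap.id := by
    have h : σ.comp σ = AffineMap.id ℝ _ := by ext1 x; exact hσ x
    have := congrArg AffineMap.linear h
    simpa using this
  have hd : LinearMap.det σ.linear * LinearMap.det σ.linear = 1 := by
    rw [← LinearMap.det_comp, hLL, LinearMap.det_id]
  have hne : LinearMap.det σ.linear ≠ 0 := fun h => by simp [h] at hd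
  have habs : |(LinearMap.det σ.linear)⁻¹| = 1 := by
    rcases mul_self_eq_one_iff.mp hd with h | h <;> simp [h]
  have h1 : MeasurePreserving σ.linear volume volume := by
    refine ⟨(LinearMap.continuous_of_finiteDimensional σ.linear).measurable, ?_⟩
    rw [Real.map_linearMap_volume_pi_eq_smul_volume_pi hne, habs]
    simp
  have h2 := (measurePreserving_add_right (volume : Measure (Fin n → ℝ)) (σ 0)).comp h1
  have : (σ : (Fin n → ℝ) → (Fin n → ℝ)) = (fun x => x + σ 0) ∘ σ.linear := by
    funext x
    have := congrFun (AffineMap.decomp σ) x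
    simpa using this
  rw [this]
  exact h2

/-- The affine involution exchanging two vertices of an affine basis. -/
noncomputable def gkzSwap {ι : Type*} {n : ℕ} (b : AffineBasis ι ℝ (Fin n → ℝ)) (i j : ι) :
    (Fin n → ℝ) →ᵃ[ℝ] (Fin n → ℝ) :=
  AffineMap.id ℝ _ +
    ((LinearMap.toSpanSingleton ℝ (Fin n → ℝ) (b j - b i)).toAffineMap).comp (b.coord i - b.coord j)

theorem gkzSwap_apply {ι : Type*} {n : ℕ} (b : AffineBasis ι ℝ (Fin n → ℝ)) (i j : ι)
    (x : Fin n → ℝ) :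
    gkzSwap b i j x = x + (b.coord i x - b.coord j x) • (b j - b i) := by
  simp [gkzSwap, sub_smul]

theorem coord_gkzSwap {ι : Type*} [DecidableEq ι] {n : ℕ} (b : AffineBasis ι ℝ (Fin n → ℝ))
    (i j k : ι) (x : Fin n → ℝ) :
    b.coord k (gkzSwap b i j x) = b.coord (Equiv.swap i j k) x := by
  have hl : (b.coord k).linear (b j - b i) = b.coord k (b j) - b.coord k (b i) := by
    simpa using (b.coord k).linearMap_vsub (b j) (b i)
  have : b.coord k (gkzSwap b i j x) =
      (b.coord i x - b.coord j x) * (b.coord k (b j) - b.coord k (b i)) + b.coord k x := by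
    rw [gkzSwap_apply, add_comm, ← vadd_eq_add, AffineMap.map_vadd, map_smul, hl]
    simp
  rw [this, b.coord_apply, b.coord_apply]
  by_cases hij : i = j
  · subst hij; simp
  by_cases hki : k = i
  · subst hki; simp [hij]
  by_cases hkj : k = j
  · subst hkj; simp [hki]
  simp [hki, hkj, Equiv.swap_apply_of_ne_of_ne]

theorem gkzSwap_invol {ι : Type*} [Fintype ι] {n : ℕ} (b : AffineBasis ι ℝ (Fin n → ℝ))
    (i j : ι) (x : Fin n → ℝ) : gkzSwap b i j (gkzSwap b i j x) = x := by
  classical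
  rw [← b.linear_combination_coord_eq_self (gkzSwap b i j (gkzSwap b i j x))]
  simp only [coord_gkzSwap, Equiv.swap_apply_self]
  exact b.linear_combination_coord_eq_self x

theorem gkz_isCompact {ι : Type*} [Fintype ι] {n : ℕ} (b : AffineBasis ι ℝ (Fin n → ℝ)) :
    IsCompact (convexHull ℝ (Set.range b)) :=
  (Set.finite_range b).isCompact_convexHull ℝ

theorem gkz_coord_integrable {ι : Type*} [Fintype ι] {n : ℕ} (b : AffineBasis ι ℝ (Fin n → ℝ))
    (i : ι) : IntegrableOn (b.coord i) (convexHull ℝ (Set.range b)) :=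
  (continuous_barycentric_coord b i).continuousOn.integrableOn_compact (gkz_isCompact b)

theorem gkz_integral_coord_eq {ι : Type*} [Fintype ι] {n : ℕ} (b : AffineBasis ι ℝ (Fin n → ℝ))
    (i j : ι) : ∫ x in convexHull ℝ (Set.range b), b.coord i x =
      ∫ x in convexHull ℝ (Set.range b), b.coord j x := by
  classical
  have hinv := gkzSwap_invol b i j
  have hmp := gkz_affine_invol_mp (gkzSwap b i j) hinv
  have hc : Continuous (gkzSwap b i j) := AffineMap.continuous_of_finiteDimensional _
  have hemb : MeasurableEmbedding (gkzSwap b i j) :=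
    hc.measurableEmbedding (Function.Involutive.injective hinv)
  have hpre : gkzSwap b i j ⁻¹' (convexHull ℝ (Set.range b)) = convexHull ℝ (Set.range b) := by
    rw [b.convexHull_eq_nonneg_coord]
    ext x
    simp only [Set.mem_preimage, Set.mem_setOf_eq, coord_gkzSwap]
    constructor
    · intro h k
      simpa using h (Equiv.swap i j k)
    · intro h k
      exact h _
  have := hmp.setIntegral_preimage_emb hemb (b.coord j) (convexHull ℝ (Set.range b))
  rw [hpre] at this
  rw [← this]
  simp [coord_gkzSwap]

theorem gkz_integral_coord {ι : Type*} [Fintype ι] {n : ℕ} (b : AffineBasis ι ℝ (Fin n → ℝ))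
    (i : ι) : (Fintype.card ι : ℝ) * ∫ x in convexHull ℝ (Set.range b), b.coord i x =
      (volume (convexHull ℝ (Set.range b))).toReal := by
  have h1 : ∑ j, ∫ x in convexHull ℝ (Set.range b), b.coord j x =
      (volume (convexHull ℝ (Set.range b))).toReal := by
    rw [← integral_finsetSum _ (fun j _ => gkz_coord_integrable b j)]
    simp [b.sum_coord_apply_eq_one, Measure.real]
  rw [← h1, Finset.sum_congr rfl (fun j _ => gkz_integral_coord_eq b j i)]
  simp

/-- The integral of an affine function over a simplex. -/
theorem gkz_simplex {n N : ℕ} (a : Fin (N + 1) → (Fin n → ℝ)) (C : Finset (Fin (N + 1)))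
    (hcard : C.card = n + 1) (hind : AffineIndependent ℝ (fun j : C => a (j : Fin (N + 1))))
    (ω : Fin (N + 1) → ℝ) (g : (Fin n → ℝ) → ℝ) (u : Fin n → ℝ) (c : ℝ)
    (hg : ∀ x ∈ convexHull ℝ (a '' (C : Set (Fin (N + 1)))), g x = (∑ i, u i * x i) + c)
    (hω : ∀ j ∈ C, ω j = (∑ i, u i * a j i) + c) :
    ((n : ℝ) + 1) * ∫ x in convexHull ℝ (a '' (C : Set (Fin (N + 1)))), g x =
      (∑ j ∈ C, ω j) * (volume (convexHull ℝ (a '' (C : Set (Fin (N + 1)))))).toReal := by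
  have htop : affineSpan ℝ (Set.range (fun j : C => a (j : Fin (N + 1)))) = ⊤ := by
    rw [hind.affineSpan_eq_top_iff_card_eq_finrank_add_one]
    simp [hcard]
  let b : AffineBasis C ℝ (Fin n → ℝ) := ⟨_, hind, htop⟩
  have hb : ∀ j, b j = a j := fun j => rfl
  have hS : a '' (C : Set (Fin (N + 1))) = Set.range b := by
    ext x
    simp [hb]
  rw [hS] at hg ⊢
  have hm : MeasurableSet (convexHull ℝ (Set.range b)) := (gkz_isCompact b).measurableSet
  have hgx : ∀ x ∈ convexHull ℝ (Set.range b), g x = ∑ j : C, ω j * b.coord j x := by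
    intro x hx
    rw [hg x hx]
    have h1 : ∀ i, x i = ∑ j : C, b.coord j x * a j i := by
      intro i
      have := congrFun (b.linear_combination_coord_eq_self x) i
      simpa [hb] using this.symm
    have h2 := b.sum_coord_apply_eq_one x
    calc (∑ i, u i * x i) + c = (∑ i, u i * ∑ j : C, b.coord j x * a j i)
          + c * ∑ j : C, b.coord j x := by
          rw [h2, mul_one]
          congr 1
          exact Finset.sum_congr rfl fun i _ => by rw [← h1 i]
      _ = ∑ j : C, ω j * b.coord j x := by
          simp_rw [Finset.mul_sum]
          rw [Finset.sum_comm, ← Finset.sum_add_distrib]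
          refine Finset.sum_congr rfl fun j _ => ?_
          rw [hω j j.2, add_mul, Finset.sum_mul]
          congr 1
          exact Finset.sum_congr rfl fun i _ => by ring
  rw [setIntegral_congr_fun hm hgx,
    integral_finsetSum _ (fun j _ => (gkz_coord_integrable b j).const_mul _), Finset.mul_sum,
    ← Finset.sum_coe_sort C, Finset.sum_mul]
  refine Finset.sum_congr rfl fun j _ => ?_
  rw [integral_const_mul, ← gkz_integral_coord b j]
  simp [hcard]
  ring

/-- ⟨ω, φ_A(T)⟩ = (n+1)! ∫_Q g_{ω,T}(x) dv, where g_{ω,T} is the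
piecewise-linear function affine on each maximal simplex of T with g(a_j) = ω_j. -/
theorem pairing_gkz_eq_integral (n N : ℕ) (a : Fin (N + 1) → (Fin n → ℝ))
    (T : Triangulation n N a) (ω : Fin (N + 1) → ℝ)
    (Q : Set (Fin n → ℝ)) (hQ : Q = convexHull ℝ (Set.range a))
    (hfull : (interior Q).Nonempty)
    (g : (Fin n → ℝ) → ℝ)
    (hg : ∀ C ∈ T.simplices, ∃ (u : Fin n → ℝ) (c : ℝ),
      (∀ x ∈ convexHull ℝ (a '' (C : Set (Fin (N + 1)))), g x = (∑ i, u i * x i) + c) ∧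
      ∀ j ∈ C, ω j = (∑ i, u i * a j i) + c) :
    ∑ j, ω j * gkzVector a T j = (Nat.factorial (n + 1) : ℝ) * ∫ x in Q, g x := by
  subst hQ
  have hcomp : ∀ C : Finset (Fin (N + 1)),
      IsCompact (convexHull ℝ (a '' (C : Set (Fin (N + 1))))) := fun C =>
    (C.finite_toSet.image a).isCompact_convexHull ℝ
  have hae : ∀ C : Finset (Fin (N + 1)),
      (interior (convexHull ℝ (a '' (C : Set (Fin (N + 1))))) : Set (Fin n → ℝ)) =ᵐ[volume]
        convexHull ℝ (a '' (C : Set (Fin (N + 1)))) := fun C =>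
    interior_ae_eq_of_null_frontier ((convex_convexHull ℝ _).addHaar_frontier volume)
  have hint : ∀ C ∈ T.simplices,
      IntegrableOn g (convexHull ℝ (a '' (C : Set (Fin (N + 1))))) := by
    intro C hC
    obtain ⟨u, c, h1, -⟩ := hg C hC
    have hcont : Continuous fun x : Fin n → ℝ => (∑ i, u i * x i) + c := by fun_prop
    exact (hcont.continuousOn.integrableOn_compact (hcomp C)).congr_fun
      (fun x hx => (h1 x hx).symm) (hcomp C).measurableSet
  have hsum : ∫ x in convexHull ℝ (Set.range a), g x =
      ∑ C ∈ T.simplices, ∫ x in convexHull ℝ (a '' (C : Set (Fin (N + 1)))), g x := by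
    have hU : (⋃ C ∈ T.simplices, interior (convexHull ℝ (a '' (C : Set (Fin (N + 1))))) :
        Set (Fin n → ℝ)) =ᵐ[volume] convexHull ℝ (Set.range a) := by
      rw [← T.covers]
      exact Filter.EventuallyEq.countable_bUnion (T.simplices.countable_toSet)
        (fun C _ => hae C)
    rw [← setIntegral_congr_set hU, integral_biUnion_finset T.simplices
      (fun C _ => isOpen_interior.measurableSet)
      (fun C hC C' hC' h => Set.disjoint_iff_inter_eq_empty.mpr (T.inter C hC C' hC' h))
      (fun C hC => (hint C hC).mono_set interior_subset)]
    exact Finset.sum_congr rfl fun C _ => setIntegral_congr_set (hae C)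
  rw [hsum, Finset.mul_sum]
  simp only [gkzVector, Finset.sum_filter, Finset.mul_sum]
  rw [Finset.sum_comm]
  refine Finset.sum_congr rfl fun C hC => ?_
  obtain ⟨u, c, h1, h2⟩ := hg C hC
  have key := gkz_simplex a C (T.card_eq C hC) (T.indep C hC) ω g u c h1 h2
  rw [Nat.factorial_succ]
  push_cast
  rw [mul_comm ((n : ℝ) + 1), mul_assoc, key, Finset.sum_mul, Finset.mul_sum]
  simp only [mul_ite, mul_zero, Finset.sum_ite_mem, Finset.univ_inter]
  exact Finset.sum_congr rfl fun j _ => by ring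
end

section
/- Let A = {a_0,…,a_N} = Q ∩ ℤ^n for a full-dimensional lattice polytope Q ⊂ ℝ^n, and suppose N + 1 = (n+1)!·Vol(Q). Then Q is unimodularly equivalent to the standard n-simplex, hence Vol(Q) = 1/n! and N = n. -/
open MeasureTheory

open Submodule in
lemma L_tight {W : Type*} [AddCommGroup W] [Module ℝ W] [FiniteDimensional ℝ W]
    (S : Set W) (hfin : S.Finite) (hS : span ℝ S = ⊤) (u : W)
    (φ0 : W →ₗ[ℝ] ℝ) (h0 : ∀ s ∈ S, φ0 s ≤ 0) (h1 : 0 < φ0 u) :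
    ∃ φ : W →ₗ[ℝ] ℝ, (∀ s ∈ S, φ s ≤ 0) ∧ 0 < φ u ∧
      span ℝ (insert u {s ∈ S | φ s = 0}) = ⊤ := by
  classical
  let P : ℕ → Prop := fun k => ∃ φ : W →ₗ[ℝ] ℝ, (∀ s ∈ S, φ s ≤ 0) ∧ 0 < φ u ∧
    Module.finrank ℝ (span ℝ {s ∈ S | φ s = 0}) = k
  have hP : P (Nat.findGreatest P (Module.finrank ℝ W)) :=
    Nat.findGreatest_spec (P := P) (m := Module.finrank ℝ (span ℝ {s ∈ S | φ0 s = 0}))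
      (Submodule.finrank_le _) ⟨φ0, h0, h1, rfl⟩
  obtain ⟨φ, hφ, hu, hk⟩ := hP
  refine ⟨φ, hφ, hu, ?_⟩
  by_contra hne
  obtain ⟨g0, hg0, hker0⟩ := Submodule.exists_le_ker_of_lt_top _ (lt_top_iff_ne_top.2 hne)
  have : ∃ s ∈ S, g0 s ≠ 0 := by
    by_contra! hall
    apply hg0
    have : span ℝ S ≤ LinearMap.ker g0 := span_le.2 fun s hs => hall s hs
    rw [hS] at this
    ext x
    exact this (mem_top : x ∈ ⊤)
  have : ∃ g : W →ₗ[ℝ] ℝ, span ℝ (insert u {s ∈ S | φ s = 0}) ≤ LinearMap.ker g ∧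
      ∃ s ∈ S, 0 < g s := by
    obtain ⟨s, hs, hgs⟩ := this
    rcases lt_or_gt_of_ne hgs with h | h
    · refine ⟨-g0, ?_, s, hs, by simpa using h⟩
      intro x hx
      have := hker0 hx
      simpa using this
    · exact ⟨g0, hker0, s, hs, h⟩
  obtain ⟨g, hker, s1, hs1, hgs1⟩ := this
  have hgu : g u = 0 := hker (subset_span (Set.mem_insert _ _))
  have hgt : ∀ s ∈ S, φ s = 0 → g s = 0 := fun s hs h =>
    hker (subset_span (Set.mem_insert_of_mem _ ⟨hs, h⟩))
  obtain ⟨s0, hs0, hmin⟩ := Set.exists_min_image {s ∈ S | 0 < g s} (fun s => -φ s / g s)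
    (hfin.subset (fun s hs => hs.1)) ⟨s1, hs1, hgs1⟩
  obtain ⟨hs0, hgs0⟩ := hs0
  set r := -φ s0 / g s0 with hr
  have hr0 : 0 ≤ r := div_nonneg (by linarith [hφ s0 hs0]) hgs0.le
  let ψ : W →ₗ[ℝ] ℝ := φ + r • g
  have hψ : ∀ x, ψ x = φ x + r * g x := fun x => by simp [ψ]
  have hψ1 : ∀ s ∈ S, ψ s ≤ 0 := by
    intro s hs
    rw [hψ]
    rcases le_or_gt (g s) 0 with h | h
    · nlinarith [hφ s hs, mul_nonneg hr0 (neg_nonneg.2 h)]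
    · have := hmin s ⟨hs, h⟩
      rw [le_div_iff₀ h] at this
      linarith
  have hψs0 : ψ s0 = 0 := by
    rw [hψ, hr]; field_simp; ring
  have hlt : span ℝ {s ∈ S | φ s = 0} < span ℝ {s ∈ S | ψ s = 0} := by
    refine lt_of_le_of_ne (span_mono ?_) ?_
    · rintro s ⟨hs, h⟩
      refine ⟨hs, ?_⟩
      rw [hψ, h, hgt s hs h]; simp
    · intro heq
      have h2 : s0 ∈ span ℝ {s ∈ S | φ s = 0} := by
        rw [heq]; exact subset_span ⟨hs0, hψs0⟩
      have h3 : g s0 = 0 := hker (span_mono (Set.subset_insert _ _) h2)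
      linarith
  have h4 := Submodule.finrank_lt_finrank_of_lt hlt
  have h5 : Module.finrank ℝ (span ℝ {s ∈ S | ψ s = 0}) ≤ Nat.findGreatest P (Module.finrank ℝ W) :=
    Nat.le_findGreatest (Submodule.finrank_le _) ⟨ψ, hψ1, by rw [hψ, hgu]; simpa using hu, rfl⟩
  omega

/-- homogenization -/
def hatt {n : ℕ} (x : Fin n → ℝ) : (Fin n → ℝ) × ℝ := (x, 1)

lemma hatt_inj {n : ℕ} : Function.Injective (hatt (n := n)) := fun x y h => by
  simpa [hatt] using h

open Submodule in
lemma L_remove {n : ℕ} (T : Finset (Fin n → ℝ)) (hT : span ℝ (hatt '' (T : Set (Fin n → ℝ))) = ⊤)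
    (hcard : n + 1 < T.card) :
    ∃ p ∈ T, p ∉ convexHull ℝ ((T.erase p : Finset (Fin n → ℝ)) : Set (Fin n → ℝ)) ∧
      span ℝ (hatt '' ((T.erase p : Finset (Fin n → ℝ)) : Set (Fin n → ℝ))) = ⊤ := by
  classical
  have key : ∀ p ∈ T, hatt p ∈ span ℝ (hatt '' ((T.erase p : Finset (Fin n → ℝ)) : Set _)) →
      span ℝ (hatt '' ((T.erase p : Finset (Fin n → ℝ)) : Set (Fin n → ℝ))) = ⊤ := by
    intro p hp h
    rw [eq_top_iff, ← hT, span_le]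
    rintro _ ⟨x, hx, rfl⟩
    by_cases hxp : x = p
    · subst hxp; exact h
    · exact subset_span ⟨x, by simpa [hxp] using hx, rfl⟩
  let D := T.filter fun p => hatt p ∈ span ℝ (hatt '' ((T.erase p : Finset (Fin n → ℝ)) : Set _))
  have hD : D.Nonempty := by
    by_contra hD
    have hli : LinearIndependent ℝ (fun t : T => hatt (t : Fin n → ℝ)) := by
      rw [linearIndependent_iff_notMem_span]
      rintro ⟨p, hp⟩ hmem
      apply hD
      refine ⟨p, Finset.mem_filter.2 ⟨hp, ?_⟩⟩
      refine span_mono ?_ hmem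
      rintro _ ⟨⟨y, hy⟩, hyp, rfl⟩
      refine ⟨y, ?_, rfl⟩
      simp at hyp
      simp [hyp, hy]
    have := hli.fintype_card_le_finrank
    simp at this
    omega
  obtain ⟨p, hp⟩ := ((D.finite_toSet.isCompact_convexHull ℝ)).extremePoints_nonempty
    (by simpa using hD)
  have hpD : p ∈ D := extremePoints_convexHull_subset hp
  rw [(convex_convexHull ℝ _).mem_extremePoints_iff_mem_sdiff_convexHull_sdiff] at hp
  have hpT := (Finset.mem_filter.1 hpD).1
  refine ⟨p, hpT, fun hconv => ?_, key p hpT (Finset.mem_filter.1 hpD).2⟩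
  apply hp.2
  rw [Finset.mem_convexHull'] at hconv
  obtain ⟨w, hw0, hw1, hwp⟩ := hconv
  have hhat : ∑ y ∈ T.erase p, w y • hatt y = hatt p := by
    simp only [hatt, Prod.smul_mk, Prod.ext_iff, Prod.fst_sum, Prod.snd_sum]
    simp [hwp, hw1]
  have hin : ∀ t ∈ T.erase p, w t ≠ 0 → t ∈ D := by
    intro t ht hwt
    have htT := Finset.mem_of_mem_erase ht
    refine Finset.mem_filter.2 ⟨htT, ?_⟩
    rw [← Finset.add_sum_erase _ _ ht] at hhat
    have h2 : hatt t = (w t)⁻¹ • (hatt p - ∑ y ∈ (T.erase p).erase t, w y • hatt y) := by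
      rw [← hhat, add_sub_cancel_right, smul_smul, inv_mul_cancel₀ hwt, one_smul]
    rw [h2]
    refine smul_mem _ _ (sub_mem (subset_span ⟨p, ?_, rfl⟩) (sum_mem fun y hy => smul_mem _ _ (subset_span ⟨y, ?_, rfl⟩)))
    · simp only [Finset.coe_erase, Set.mem_sdiff, Finset.mem_coe, Set.mem_singleton_iff]
      exact ⟨hpT, fun h => (Finset.ne_of_mem_erase ht) h.symm⟩
    · simp only [Finset.mem_erase] at hy
      simp [hy.1, hy.2.2]
  have : ∑ y ∈ T.erase p, w y • y ∈ convexHull ℝ ((convexHull ℝ (D : Set (Fin n → ℝ))) \ {p}) := by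
    have hs : ∑ y ∈ (T.erase p).filter (fun y => w y ≠ 0), w y • y = ∑ y ∈ T.erase p, w y • y := by
      apply Finset.sum_filter_of_ne
      intro y _ hy h
      apply hy; simp [h]
    rw [← hs]
    apply (convex_convexHull ℝ _).sum_mem
    · intro i hi; exact hw0 i (Finset.mem_filter.1 hi).1
    · rw [Finset.sum_filter_ne_zero]; exact hw1
    · intro i hi
      obtain ⟨hi1, hi2⟩ := Finset.mem_filter.1 hi
      exact subset_convexHull ℝ _ ⟨subset_convexHull ℝ _ (hin i hi1 hi2), Finset.ne_of_mem_erase hi1⟩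
  rwa [hwp] at this
lemma std_mem {n : ℕ} (x : Fin n → ℝ) (h0 : ∀ i, 0 ≤ x i) (h1 : ∑ i, x i ≤ 1) :
    x ∈ stdSimplexSet n := by
  have hc : Convex ℝ (stdSimplexSet n) := convex_convexHull ℝ _
  have := hc.sum_mem (t := Finset.univ) (w := fun o : Option (Fin n) => o.elim (1 - ∑ i, x i) x)
    (z := fun o : Option (Fin n) => o.elim (0 : Fin n → ℝ) (fun i j => if i = j then (1 : ℝ) else 0))
    (by rintro (_ | i) _ <;> simp [h0, h1])
    (by simp [Fintype.sum_option])
    (by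
      rintro (_ | i) _
      · exact subset_convexHull ℝ _ (Set.mem_insert _ _)
      · exact subset_convexHull ℝ _ (Set.mem_insert_of_mem _ ⟨i, rfl⟩))
  convert this using 1
  ext j
  simp [Fintype.sum_option]

lemma std_vol (n : ℕ) : ENNReal.ofReal (1 / (n.factorial : ℝ)) ≤ volume (stdSimplexSet n) := by
  have h := MeasureTheory.volume_sum_rpow_lt_one (Fin n) (p := 1) le_rfl
  have hG : Real.Gamma 2 = 1 := Real.Gamma_two
  simp only [Real.rpow_one, div_one, Fintype.card_fin, Real.Gamma_nat_eq_factorial] at h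
  norm_num at h
  let f : (Fin n → Bool) → ((Fin n → ℝ) →ₗ[ℝ] (Fin n → ℝ)) := fun e =>
    Matrix.toLin' (Matrix.diagonal fun i => if e i then (1 : ℝ) else -1)
  have hsub : {x : Fin n → ℝ | ∑ i, |x i| < 1} ⊆ ⋃ e, f e '' stdSimplexSet n := by
    intro x hx
    refine Set.mem_iUnion.2 ⟨fun i => decide (0 ≤ x i), fun i => |x i|,
      std_mem _ (fun i => abs_nonneg _) (le_of_lt hx), ?_⟩
    ext i
    simp only [f, Matrix.toLin'_apply, Matrix.mulVec_diagonal, decide_eq_true_eq]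
    split_ifs with hi
    · simp [abs_of_nonneg hi]
    · simp [abs_of_neg (not_le.1 hi)]
  have hvol : ∀ e, volume (f e '' stdSimplexSet n) = volume (stdSimplexSet n) := by
    intro e
    rw [Measure.addHaar_image_linearMap, LinearMap.det_toLin', Matrix.det_diagonal,
      Finset.abs_prod, Finset.prod_eq_one]
    · simp
    · intro i _; split_ifs <;> simp
  have h2 := (measure_mono hsub).trans (measure_iUnion_fintype_le volume _)
  simp only [hvol, Finset.sum_const, Finset.card_univ, Fintype.card_fun, Fintype.card_bool,
    Fintype.card_fin, nsmul_eq_mul] at h2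
  rw [h] at h2
  have h3 : ENNReal.ofReal (2 ^ n / n.factorial) = ((2 ^ n : ℕ) : ENNReal) * ENNReal.ofReal (1 / n.factorial) := by
    rw [← ENNReal.ofReal_natCast, ← ENNReal.ofReal_mul (by positivity)]
    push_cast; congr 1; ring
  rw [h3] at h2
  exact (ENNReal.mul_le_mul_iff_right (by simp) (by simp)).1 h2

/-- real embedding of integer vectors -/
def embz {n : ℕ} (v : Fin n → ℤ) : Fin n → ℝ := fun i => (v i : ℝ)

lemma embz_inj {n : ℕ} : Function.Injective (embz (n := n)) := fun x y h => by
  ext i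
  have := congrFun h i
  simpa [embz] using this

/-- edge matrix -/
def edgeM {n : ℕ} (p : Fin n → ℤ) (q : Fin n → Fin n → ℤ) : Matrix (Fin n) (Fin n) ℤ :=
  Matrix.of fun i j => q j i - p i

lemma simplex_image {n : ℕ} (p : Fin n → ℤ) (q : Fin n → Fin n → ℤ) :
    (fun x : Fin n → ℝ => fun i => (∑ j, (edgeM p q i j : ℝ) * x j) + (p i : ℝ)) '' stdSimplexSet n
      = convexHull ℝ (insert (embz p) (Set.range fun j => embz (q j))) := by
  let F : (Fin n → ℝ) →ᵃ[ℝ] (Fin n → ℝ) :=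
    (Matrix.toLin' ((edgeM p q).map (fun z : ℤ => (z : ℝ)))).toAffineMap + AffineMap.const ℝ _ (embz p)
  have hF : (fun x : Fin n → ℝ => fun i => (∑ j, (edgeM p q i j : ℝ) * x j) + (p i : ℝ)) = F := by
    ext x i
    simp [F, Matrix.mulVec, dotProduct, embz]
  rw [hF, stdSimplexSet, AffineMap.image_convexHull, Set.image_insert_eq, ← Set.range_comp, ← hF]
  congr 2
  · ext i; simp [embz]
  · congr 1
    ext j i
    simp [embz, edgeM]

lemma simplex_vol {n : ℕ} (p : Fin n → ℤ) (q : Fin n → Fin n → ℤ) :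
    ENNReal.ofReal (|((edgeM p q).det : ℝ)| * (1 / n.factorial)) ≤
      volume (convexHull ℝ (insert (embz p) (Set.range fun j => embz (q j)))) := by
  rw [← simplex_image]
  have : (fun x : Fin n → ℝ => fun i => (∑ j, (edgeM p q i j : ℝ) * x j) + (p i : ℝ)) =
    (fun y => embz p + y) ∘ Matrix.toLin' ((edgeM p q).map (fun z : ℤ => (z : ℝ))) := by
    ext x i
    simp [Matrix.mulVec, dotProduct, embz, add_comm]
  rw [this, Set.image_comp, Set.image_add_left, measure_preimage_add,
    Measure.addHaar_image_linearMap, LinearMap.det_toLin', ENNReal.ofReal_mul (abs_nonneg _)]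
  have hd : ((edgeM p q).map (fun z : ℤ => (z : ℝ))).det = ((edgeM p q).det : ℝ) := by
    have := (Int.castRingHom ℝ).map_det (edgeM p q)
    simpa [RingHom.mapMatrix_apply] using this.symm
  rw [hd]
  gcongr
  exact std_vol n

open Submodule in
lemma L_pick {n : ℕ} (p : Fin n → ℤ) (U : Set (Fin n → ℝ)) (hU : ∀ x ∈ U, ∃ z, embz z = x)
    (hs : span ℝ (insert (hatt (embz p)) (hatt '' U)) = ⊤) :
    ∃ q : Fin n → Fin n → ℤ, (∀ j, embz (q j) ∈ U) ∧ (edgeM p q).det ≠ 0 := by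
  let L : ((Fin n → ℝ) × ℝ) →ₗ[ℝ] (Fin n → ℝ) :=
    LinearMap.fst ℝ _ _ - (LinearMap.snd ℝ (Fin n → ℝ) ℝ).smulRight (embz p)
  have hL : ∀ x, L (hatt x) = x - embz p := fun x => by simp [L, hatt]
  have hsurj : LinearMap.range L = ⊤ := by
    rw [LinearMap.range_eq_top]
    intro x; exact ⟨(x, 0), by simp [L]⟩
  have h1 : span ℝ ((fun x => x - embz p) '' U) = ⊤ := by
    rw [eq_top_iff, ← hsurj, LinearMap.range_eq_map, ← hs, map_span, span_le]
    rintro _ ⟨y, hy, rfl⟩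
    rcases hy with rfl | ⟨x, hx, rfl⟩
    · rw [hL]; simp
    · rw [hL]; exact subset_span ⟨x, hx, rfl⟩
  obtain ⟨f, hf, -, hli⟩ := Submodule.exists_fun_fin_finrank_span_eq ℝ ((fun x => x - embz p) '' U)
  have hn : n = Module.finrank ℝ (span ℝ ((fun x => x - embz p) '' U)) := by
    rw [h1]; simp
  have hli' : LinearIndependent ℝ (fun i : Fin n => f (Fin.cast hn i)) :=
    hli.comp _ (Fin.cast_injective hn)
  have hf' : ∀ i : Fin n, ∃ z, embz z ∈ U ∧ embz z - embz p = f (Fin.cast hn i) := by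
    intro i
    obtain ⟨x, hx, hxf⟩ := hf (Fin.cast hn i)
    obtain ⟨z, rfl⟩ := hU x hx
    exact ⟨z, hx, hxf⟩
  choose q hq1 hq2 using hf'
  refine ⟨q, hq1, ?_⟩
  have hrow : ((edgeM p q).map (fun z : ℤ => (z : ℝ))).transpose.row = fun i : Fin n => f (Fin.cast hn i) := by
    ext i j
    rw [← hq2]
    simp [edgeM, embz, Matrix.row]
  rw [← hrow, Matrix.linearIndependent_rows_iff_isUnit, Matrix.isUnit_iff_isUnit_det,
    Matrix.det_transpose] at hli'
  have hd : ((edgeM p q).map (fun z : ℤ => (z : ℝ))).det = ((edgeM p q).det : ℝ) := by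
    have := (Int.castRingHom ℝ).map_det (edgeM p q)
    simpa [RingHom.mapMatrix_apply] using this.symm
  rw [hd] at hli'
  exact_mod_cast hli'.ne_zero

lemma simplex_vol' {n : ℕ} (p : Fin n → ℤ) (q : Fin n → Fin n → ℤ) (h : (edgeM p q).det ≠ 0) :
    ENNReal.ofReal (1 / n.factorial) ≤
      volume (convexHull ℝ (insert (embz p) (Set.range fun j => embz (q j)))) := by
  refine le_trans (ENNReal.ofReal_le_ofReal ?_) (simplex_vol p q)
  have : (1 : ℝ) ≤ |((edgeM p q).det : ℝ)| := by exact_mod_cast Int.one_le_abs h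
  exact le_mul_of_one_le_left (by positivity) this
open Submodule in
lemma L_step {n : ℕ} (T' : Finset (Fin n → ℝ)) (hint : ∀ x ∈ T', ∃ z, embz z = x)
    (hs : span ℝ (hatt '' (T' : Set (Fin n → ℝ))) = ⊤) (p : Fin n → ℤ)
    (hp : embz p ∉ convexHull ℝ (T' : Set (Fin n → ℝ))) :
    volume (convexHull ℝ (T' : Set (Fin n → ℝ))) + ENNReal.ofReal (1 / n.factorial) ≤
      volume (convexHull ℝ (insert (embz p) (T' : Set (Fin n → ℝ)))) := by
  have hcl : IsClosed (convexHull ℝ (T' : Set (Fin n → ℝ))) :=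
    T'.finite_toSet.isClosed_convexHull ℝ
  obtain ⟨f, u, hf1, hf2⟩ := geometric_hahn_banach_closed_point (convex_convexHull ℝ _) hcl hp
  let φ0 : ((Fin n → ℝ) × ℝ) →ₗ[ℝ] ℝ :=
    (f : (Fin n → ℝ) →ₗ[ℝ] ℝ).comp (LinearMap.fst ℝ _ _) - u • LinearMap.snd ℝ (Fin n → ℝ) ℝ
  have hφ0 : ∀ x, φ0 (hatt x) = f x - u := fun x => by simp [φ0, hatt]
  obtain ⟨φ, h1, h2, h3⟩ := L_tight (hatt '' (T' : Set (Fin n → ℝ))) (T'.finite_toSet.image _) hs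
    (hatt (embz p)) φ0
    (by
      rintro _ ⟨x, hx, rfl⟩
      rw [hφ0]
      linarith [hf1 x (subset_convexHull ℝ _ hx)])
    (by rw [hφ0]; linarith)
  obtain ⟨q, hq1, hq2⟩ := L_pick p {x ∈ (T' : Set (Fin n → ℝ)) | φ (hatt x) = 0}
    (fun x hx => hint x hx.1) (by
      rw [← h3]
      congr 2
      ext y
      constructor
      · rintro ⟨x, ⟨hx1, hx2⟩, rfl⟩
        exact ⟨⟨x, hx1, rfl⟩, hx2⟩
      · rintro ⟨⟨x, hx1, rfl⟩, hx2⟩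
        exact ⟨x, ⟨hx1, hx2⟩, rfl⟩)
  let F : (Fin n → ℝ) →ᵃ[ℝ] ℝ :=
    (φ.comp (LinearMap.inl ℝ (Fin n → ℝ) ℝ)).toAffineMap + AffineMap.const ℝ _ (φ (0, 1))
  have hF : ∀ x, F x = φ (hatt x) := fun x => by
    simp [F, hatt, ← map_add]
  set Δ := convexHull ℝ (insert (embz p) (Set.range fun j => embz (q j))) with hΔ
  have hA : convexHull ℝ (T' : Set (Fin n → ℝ)) ⊆ F ⁻¹' (Set.Iic 0) :=
    convexHull_min (fun x hx => by simpa [hF] using h1 _ ⟨x, hx, rfl⟩)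
      ((convex_Iic (0 : ℝ)).affine_preimage F)
  have hB : Δ ⊆ F ⁻¹' (Set.Ici 0) := by
    refine convexHull_min ?_ ((convex_Ici (0 : ℝ)).affine_preimage F)
    rintro x (rfl | ⟨j, rfl⟩)
    · simpa [hF] using h2.le
    · simpa [hF] using (hq1 j).2.ge
  have hnull : volume (F ⁻¹' {0}) = 0 := by
    let S : AffineSubspace ℝ (Fin n → ℝ) := (AffineSubspace.mk' (0 : ℝ) ⊥).comap F
    have hS : (S : Set (Fin n → ℝ)) = F ⁻¹' {0} := by
      ext x; simp [S]
    rw [← hS]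
    apply Measure.addHaar_affineSubspace
    intro htop
    have : embz p ∈ (S : Set (Fin n → ℝ)) := by rw [htop]; trivial
    rw [hS] at this
    simp [hF] at this
    linarith
  have hdis : AEDisjoint volume (convexHull ℝ (T' : Set (Fin n → ℝ))) Δ := by
    refine measure_mono_null ?_ hnull
    rintro x ⟨hx1, hx2⟩
    exact le_antisymm (hA hx1) (hB hx2)
  have hmeas : NullMeasurableSet Δ volume :=
    (((Set.finite_range _).insert _).isClosed_convexHull ℝ).measurableSet.nullMeasurableSet
  calc _ ≤ volume (convexHull ℝ (T' : Set (Fin n → ℝ))) + volume Δ := by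
        gcongr; exact simplex_vol' p q hq2
    _ = volume (convexHull ℝ (T' : Set (Fin n → ℝ)) ∪ Δ) := (measure_union₀ hmeas hdis).symm
    _ ≤ _ := by
      refine measure_mono (Set.union_subset (convexHull_mono (Set.subset_insert _ _))
        (convexHull_mono (Set.insert_subset_insert ?_)))
      rintro _ ⟨j, rfl⟩
      exact (hq1 j).1

open Submodule in
lemma blichfeldt {n : ℕ} (m : ℕ) : ∀ (T : Finset (Fin n → ℝ)), T.card = m + n + 1 →
    (∀ x ∈ T, ∃ z, embz z = x) → span ℝ (hatt '' (T : Set (Fin n → ℝ))) = ⊤ →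
    ENNReal.ofReal ((m + 1) * (1 / n.factorial)) ≤ volume (convexHull ℝ (T : Set (Fin n → ℝ))) := by
  classical
  induction m with
  | zero =>
    intro T hc hint hs
    obtain ⟨x, hx⟩ : T.Nonempty := Finset.card_pos.1 (by omega)
    obtain ⟨p, rfl⟩ := hint x hx
    obtain ⟨q, hq1, hq2⟩ := L_pick p (T : Set (Fin n → ℝ)) hint
      (by rw [eq_top_iff, ← hs]; exact span_mono (Set.subset_insert _ _))
    have := simplex_vol' p q hq2
    simp only [Nat.cast_zero, zero_add, one_mul]
    refine this.trans (measure_mono (convexHull_mono ?_))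
    rintro y (rfl | ⟨j, rfl⟩)
    · exact hx
    · exact hq1 j
  | succ m ih =>
    intro T hc hint hs
    obtain ⟨x, hx, hx1, hx2⟩ := L_remove T hs (by omega)
    obtain ⟨p, rfl⟩ := hint x hx
    have hi' : ∀ y ∈ T.erase (embz p), ∃ z, embz z = y :=
      fun y hy => hint y (Finset.mem_of_mem_erase hy)
    have h1 := ih (T.erase (embz p)) (by rw [Finset.card_erase_of_mem hx]; omega) hi' hx2
    have h2 := L_step _ hi' hx2 p hx1
    rw [← Finset.coe_insert, Finset.insert_erase hx] at h2
    refine le_trans ?_ h2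
    refine le_trans ?_ (add_le_add_left h1 _)
    rw [← ENNReal.ofReal_add (by positivity) (by positivity)]
    apply le_of_eq; congr 1; push_cast; ring

open Submodule in
lemma span_of_affine {n : ℕ} (A : Set (Fin n → ℝ)) (h : affineSpan ℝ A = ⊤) :
    span ℝ (hatt '' A) = ⊤ := by
  have hne : A.Nonempty := by
    rw [← affineSpan_nonempty ℝ, h]; exact ⟨0, trivial⟩
  obtain ⟨a, ha⟩ := hne
  have hv : vectorSpan ℝ A = ⊤ := by
    rw [← direction_affineSpan, h, AffineSubspace.direction_top]
  rw [vectorSpan_eq_span_vsub_set_right ℝ ha] at hv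
  have h0 : ∀ x : Fin n → ℝ, (x, (0 : ℝ)) ∈ span ℝ (hatt '' A) := by
    have : (⊤ : Submodule ℝ (Fin n → ℝ)) ≤ (span ℝ (hatt '' A)).comap (LinearMap.inl ℝ (Fin n → ℝ) ℝ) := by
      rw [← hv, span_le]
      rintro _ ⟨x, hx, rfl⟩
      have : (x - a, (0 : ℝ)) = hatt x - hatt a := by simp [hatt]
      simp only [vsub_eq_sub, SetLike.mem_coe, mem_comap, LinearMap.inl_apply]
      rw [this]
      exact sub_mem (subset_span ⟨x, hx, rfl⟩) (subset_span ⟨a, ha, rfl⟩)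
    intro x
    exact this (mem_top : x ∈ ⊤)
  rw [eq_top_iff]
  rintro ⟨x, c⟩ -
  have : (x, c) = (x - c • a, (0 : ℝ)) + c • hatt a := by simp [hatt]
  rw [this]
  exact add_mem (h0 _) (smul_mem _ _ (subset_span ⟨a, ha, rfl⟩))

/-- if A = {a_0,…,a_N} = Q ∩ ℤ^n and N+1 = (n+1)!·Vol(Q), then Q is
unimodularly equivalent to the standard n-simplex, Vol(Q) = 1/n! and N = n. -/
theorem eq_case_standard_simplex (n N : ℕ) (a : Fin (N + 1) → (Fin n → ℤ))
    (V : Finset (Fin n → ℤ)) (Q : Set (Fin n → ℝ))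
    (hQ : Q = convexHull ℝ ((fun v : Fin n → ℤ => fun i => (v i : ℝ)) '' V))
    (hfull : (interior Q).Nonempty)
    (hinj : Function.Injective a)
    (henum : ∀ x : Fin n → ℤ, ((fun i => (x i : ℝ)) ∈ Q) ↔ ∃ j, a j = x)
    (hN : ((N : ℝ) + 1) = (Nat.factorial (n + 1) : ℝ) * (volume Q).toReal) :
    UnimodEquivStdSimplex n Q ∧
      (volume Q).toReal = 1 / (Nat.factorial n : ℝ) ∧ N = n := by
  classical
  let T : Finset (Fin n → ℝ) := Finset.univ.image fun j => embz (a j)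
  have hTcard : T.card = N + 1 := by
    have h := Finset.card_image_of_injective Finset.univ (embz_inj.comp hinj)
    simp only [Finset.card_univ, Fintype.card_fin] at h
    exact h
  have hint : ∀ x ∈ T, ∃ z, embz z = x := by
    intro x hx
    obtain ⟨j, -, rfl⟩ := Finset.mem_image.1 hx
    exact ⟨_, rfl⟩
  have hQT : Q = convexHull ℝ (T : Set (Fin n → ℝ)) := by
    apply Set.Subset.antisymm
    · conv_lhs => rw [hQ]
      apply convexHull_mono
      rintro _ ⟨v, hv, rfl⟩
      obtain ⟨j, rfl⟩ := (henum v).1 (by rw [hQ]; exact subset_convexHull ℝ _ ⟨v, hv, rfl⟩)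
      exact Finset.mem_coe.2 (Finset.mem_image.2 ⟨j, Finset.mem_univ _, rfl⟩)
    · refine convexHull_min ?_ (by rw [hQ]; exact convex_convexHull ℝ _)
      intro x hx
      obtain ⟨j, -, rfl⟩ := Finset.mem_image.1 (Finset.mem_coe.1 hx)
      exact (henum (a j)).2 ⟨j, rfl⟩
  have hspan : Submodule.span ℝ (hatt '' (T : Set (Fin n → ℝ))) = ⊤ := by
    apply span_of_affine
    rw [hQT] at hfull
    exact interior_convexHull_nonempty_iff_affineSpan_eq_top.1 hfull
  have hge : n ≤ N := by
    have h1 := finrank_span_finset_le_card (R := ℝ) (T.image hatt)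
    rw [Set.finrank, Finset.coe_image, hspan] at h1
    have h2 : (T.image hatt).card ≤ T.card := Finset.card_image_le
    simp at h1
    omega
  obtain ⟨m, rfl⟩ := Nat.exists_eq_add_of_le' hge
  have hfin : volume Q ≠ ⊤ := by
    rw [hQT]
    exact (T.finite_toSet.isCompact_convexHull ℝ).measure_lt_top.ne
  have hb := blichfeldt m T (by omega) hint hspan
  rw [← hQT] at hb
  have hb' := (ENNReal.ofReal_le_iff_le_toReal hfin).1 hb
  have hfac : (0 : ℝ) < n.factorial := by positivity
  rw [Nat.factorial_succ] at hN
  push_cast at hN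
  set v := (volume Q).toReal with hv
  have hb2 : (m : ℝ) + 1 ≤ n.factorial * v := by
    rw [mul_one_div, div_le_iff₀ hfac] at hb'
    linarith
  have hm : m = 0 := by
    rcases Nat.eq_zero_or_pos n with rfl | hn
    · have : Fintype.card (Fin (m + 0 + 1)) ≤ 1 := by
        rw [Fintype.card_le_one_iff]
        intro x y
        exact hinj (Subsingleton.elim _ _)
      simpa using this
    · have hn' : (1 : ℝ) ≤ n := by exact_mod_cast hn
      have : (m : ℝ) ≤ 0 := by nlinarith [mul_le_mul_of_nonneg_left hb2 (by positivity : (0 : ℝ) ≤ n + 1)]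
      have : m ≤ 0 := by exact_mod_cast this
      omega
  subst hm
  have hv1 : v = 1 / n.factorial := by
    rw [eq_div_iff hfac.ne']
    have hn' : (0 : ℝ) < n + 1 := by positivity
    apply mul_left_cancel₀ hn'.ne'
    push_cast at hN
    linarith
  refine ⟨?_, hv1, by simp⟩
  obtain ⟨q, hq1, hq2⟩ := L_pick (a 0) (T : Set (Fin n → ℝ)) hint
    (by rw [eq_top_iff, ← hspan]; exact Submodule.span_mono (Set.subset_insert _ _))
  have hsub : insert (embz (a 0)) (Finset.univ.image fun j => embz (q j)) ⊆ T := by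
    intro x hx
    rcases Finset.mem_insert.1 hx with rfl | hx
    · exact Finset.mem_image.2 ⟨0, Finset.mem_univ _, rfl⟩
    · obtain ⟨j, -, rfl⟩ := Finset.mem_image.1 hx
      exact hq1 j
  have hqinj : Function.Injective q := by
    intro i j hij
    by_contra hne
    exact hq2 (Matrix.det_zero_of_column_eq hne (fun k => by simp [edgeM, hij]))
  have hq0 : ∀ j, q j ≠ a 0 := by
    intro j hj
    exact hq2 (Matrix.det_eq_zero_of_column_eq_zero j (fun k => by simp [edgeM, hj]))
  have heq : insert (embz (a 0)) (Finset.univ.image fun j => embz (q j)) = T := by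
    apply Finset.eq_of_subset_of_card_le hsub
    rw [hTcard, Finset.card_insert_of_notMem]
    · have h := Finset.card_image_of_injective Finset.univ (embz_inj.comp hqinj)
      simp only [Finset.card_univ, Fintype.card_fin] at h
      simp only [Function.comp_def] at h
      omega
    · intro h
      obtain ⟨j, -, hj⟩ := Finset.mem_image.1 h
      exact hq0 j (embz_inj hj)
  have hQ2 : Q = convexHull ℝ (insert (embz (a 0)) (Set.range fun j => embz (q j))) := by
    rw [hQT, ← heq]; simp
  refine ⟨edgeM (a 0) q, a 0, ?_, ?_⟩
  · have h1 := simplex_vol (a 0) q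
    rw [← hQ2, ENNReal.ofReal_le_iff_le_toReal hfin, ← hv, hv1] at h1
    have h2 : |((edgeM (a 0) q).det : ℝ)| ≤ 1 := by
      rw [mul_one_div, div_le_div_iff_of_pos_right hfac] at h1
      exact h1
    have h3 : |(edgeM (a 0) q).det| ≤ 1 := by exact_mod_cast h2
    rw [Int.isUnit_iff_abs_eq]
    exact le_antisymm h3 (Int.one_le_abs hq2)
  · rw [simplex_image, hQ2]
end
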